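/- Let d ≥ 3 be an integer. For a general pencil of plane curves of degree d over ℂ and a general point x ∈ ℙ², the number of lines L through x such that L is a flex tangent line of some member of the pencil (i.e., L has contact order at least 3 with that member at some point) is exactly 3d(d − 2). -/

import Mathlib

noncomputable section

/-- The restriction of the form `F` to the line through `[v]` and `[w]`,
parametrized by `t ↦ v + t • w`, as a polynomial in `t`. -/
def linePoly (F : MvPolynomial (Fin 3) ℂ) (v w : Fin 3 → ℂ) : Polynomial ℂ :=
  MvPolynomial.aeval (fun i => Polynomial.C (v i) + Polynomial.X * Polynomial.C (w i)) F

/-- The line through the two (projectively distinct) points `[v]`, `[w]` has contact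
order at least `m` with the curve `{F = 0}` at the point `[v]`. -/
def ContactLE (F : MvPolynomial (Fin 3) ℂ) (v w : Fin 3 → ℂ) (m : ℕ) : Prop :=
  (Polynomial.X : Polynomial ℂ) ^ m ∣ linePoly F v w

/-- The member of the pencil spanned by `F` and `G` corresponding to `c ∈ ℙ¹`. -/
def pencilMember (F G : MvPolynomial (Fin 3) ℂ) (c : Projectivization ℂ (Fin 2 → ℂ)) :
    MvPolynomial (Fin 3) ℂ :=
  c.rep 0 • F + c.rep 1 • G

/-- The coefficient vector of a pair of forms. -/
def coeffs2 (F G : MvPolynomial (Fin 3) ℂ) : (Fin 3 →₀ ℕ) ⊕ (Fin 3 →₀ ℕ) → ℂ :=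
  Sum.elim (fun m => MvPolynomial.coeff m F) (fun m => MvPolynomial.coeff m G)

/-- The set of lines (2-dimensional linear subspaces of `ℂ³`) through the point `[x]`
which are flex tangent lines of some member of the pencil spanned by `F` and `G`, i.e.
have contact order at least 3 with that member at some point. -/
def flexLinesThrough (F G : MvPolynomial (Fin 3) ℂ) (x : Fin 3 → ℂ) :
    Set (Submodule ℂ (Fin 3 → ℂ)) :=
  {W | x ∈ W ∧ Module.finrank ℂ ↥W = 2 ∧
    ∃ (c : Projectivization ℂ (Fin 2 → ℂ)) (v w : Fin 3 → ℂ),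
      v ∈ W ∧ w ∈ W ∧ LinearIndependent ℂ ![v, w] ∧
      ContactLE (pencilMember F G c) v w 3}


open Polynomial in
lemma syl_mulVec {m n : ℕ} (w : Fin (m + n) → ℂ) :
    ∃ p q : ℂ[X], p.degree < m ∧ q.degree < n ∧ (p = 0 → q = 0 → w = 0) ∧
      ∀ f g : ℂ[X], f.natDegree ≤ m → g.natDegree ≤ n → ∀ i : Fin (m + n),
        (Matrix.mulVec (sylvester f g m n) w) i = (f * q + g * p).coeff i := by
  let b₁ := ((degreeLT.basis ℂ m).prod (degreeLT.basis ℂ n)).reindex finSumFinEquiv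
  let pq := b₁.equivFun.symm w
  refine ⟨pq.1.1, pq.2.1, mem_degreeLT.1 pq.1.2, mem_degreeLT.1 pq.2.2, ?_, ?_⟩
  · intro h1 h2
    have : pq = 0 := Prod.ext (Subtype.ext h1) (Subtype.ext h2)
    exact (LinearEquiv.map_eq_zero_iff _).1 this
  · intro f g hf hg i
    have h := LinearMap.toMatrix_mulVec_repr b₁ (degreeLT.basis ℂ (m+n)) (sylvesterMap f g hf hg) pq
    rw [toMatrix_sylvesterMap'] at h
    have h2 : (b₁.repr pq : Fin (m+n) → ℂ) = w := by
      exact b₁.equivFun.apply_symm_apply w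
    rw [h2] at h
    rw [h, degreeLT.basis_repr]
    simp [sylvesterMap]

open Polynomial in
lemma double_root_det {N : ℕ} (M : Matrix (Fin N) (Fin N) ℂ[X]) (e : Fin N → ℂ) (i0 : Fin N)
    (he : e i0 = 1) (u0 : ℂ) (hz : ∀ j, (∑ i, C (e i) * M i j).eval u0 = 0)
    (hd : (X - C u0) ^ 2 ∣ M.det) :
    ∃ w : Fin N → ℂ, w ≠ 0 ∧ Matrix.mulVec (M.map (eval u0)) w = 0 ∧
      ∑ j, (derivative (∑ i, C (e i) * M i j)).eval u0 * w j = 0 := by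
  have h1 : ∀ j, ∃ q, (∑ i, C (e i) * M i j) = (X - C u0) * q := fun j =>
    (dvd_iff_isRoot.2 (hz j))
  choose q hq using h1
  have h2 : (M.updateRow i0 ((X - C u0) • q)).det = M.det := by
    have := Matrix.det_updateRow_sum M i0 (fun i => C (e i))
    rw [he] at this
    simp only [map_one, one_smul] at this
    rw [← this]
    congr 2
    ext1 j
    simp [← hq, Finset.sum_apply]
  rw [Matrix.det_updateRow_smul] at h2
  rw [← h2, pow_two] at hd
  have h3 := (mul_dvd_mul_iff_left (X_sub_C_ne_zero u0)).1 hd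
  have h4 : ((M.updateRow i0 q).map (eval u0)).det = 0 := by
    have := dvd_iff_isRoot.1 h3
    rw [IsRoot, ← coe_evalRingHom, RingHom.map_det] at this
    exact this
  obtain ⟨w, hw, hw2⟩ := Matrix.exists_mulVec_eq_zero_iff.2 h4
  have h5 : ∀ i, i ≠ i0 → (Matrix.mulVec (M.map (eval u0)) w) i = 0 := by
    intro i hi
    have := congrFun hw2 i
    simpa [Matrix.mulVec, dotProduct, Matrix.updateRow_ne hi] using this
  have h6 : ∑ j, (q j).eval u0 * w j = 0 := by
    have := congrFun hw2 i0
    simpa [Matrix.mulVec, dotProduct] using this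
  refine ⟨w, hw, ?_, ?_⟩
  · ext i
    by_cases hi : i = i0
    · subst hi
      have : ∑ k, e k * (Matrix.mulVec (M.map (eval u0)) w) k = 0 := by
        simp only [Matrix.mulVec, dotProduct, Finset.mul_sum]
        rw [Finset.sum_comm]
        apply Finset.sum_eq_zero
        intro j _
        have := hz j
        simp only [eval_finsetSum, eval_mul, eval_C] at this
        simp only [Matrix.map_apply, ← mul_assoc, ← Finset.sum_mul, this, zero_mul]
      rw [Finset.sum_eq_single i (fun k _ hk => by rw [h5 k hk, mul_zero]) (by simp), he, one_mul]
        at this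
      simpa using this
    · simpa using h5 i hi
  · rw [← h6]
    apply Finset.sum_congr rfl
    intro j _
    rw [hq]
    simp

open Polynomial in
/-- coefficientwise derivative of a bivariate polynomial -/
noncomputable def dU (A : ℂ[X][X]) : ℂ[X][X] := ∑ k ∈ Finset.range (A.natDegree + 1), monomial k (derivative (A.coeff k))

open Polynomial in
lemma dU_coeff (A : ℂ[X][X]) (k : ℕ) : (dU A).coeff k = derivative (A.coeff k) := by
  unfold dU
  simp only [finsetSum_coeff, coeff_monomial]
  rw [Finset.sum_ite_eq']
  split_ifs with h
  · rfl
  · rw [coeff_eq_zero_of_natDegree_lt (by simpa using h)]; simp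

open Polynomial in
lemma dU_natDegree {A : ℂ[X][X]} {m : ℕ} (h : A.natDegree ≤ m) : (dU A).natDegree ≤ m := by
  rw [natDegree_le_iff_coeff_eq_zero] at h ⊢
  intro k hk
  rw [dU_coeff, h k hk]; simp

open Polynomial in
/-- restriction to the line `u = u0` -/
noncomputable abbrev atU (u0 : ℂ) (A : ℂ[X][X]) : ℂ[X] := A.map (evalRingHom u0)

open Polynomial in
lemma sum_coeff_eval {N : ℕ} (p : ℂ[X]) (hp : p.degree < N) (z : ℂ) :
    ∑ i : Fin N, z ^ (i : ℕ) * p.coeff i = p.eval z := by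
  rw [Fin.sum_univ_eq_sum_range (fun i => z ^ i * p.coeff i)]
  by_cases h0 : p = 0
  · simp [h0]
  rw [eval_eq_sum_range' ((natDegree_lt_iff_degree_lt h0).2 hp)]
  exact Finset.sum_congr rfl fun _ _ => mul_comm _ _

open Polynomial in
lemma syl_deg {m n : ℕ} {f g p q : ℂ[X]} (hp : p.degree < m) (hq : q.degree < n)
    (hf : f.natDegree ≤ m) (hg : g.natDegree ≤ n) : (f * q + g * p).degree < (m + n : ℕ) := by
  exact mem_degreeLT.1 (sylvesterMap f g hf hg (⟨p, mem_degreeLT.2 hp⟩, ⟨q, mem_degreeLT.2 hq⟩)).2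

open Polynomial in
lemma deg_mul_const {A e : ℂ[X]} {m : ℕ} (hA : A.natDegree = m) (hA0 : A ≠ 0)
    (h : (A * e).degree < (m+1 : ℕ)) : ∃ c, e = C c := by
  by_cases he : e = 0
  · exact ⟨0, by simp [he]⟩
  have h1 := (natDegree_lt_iff_degree_lt (mul_ne_zero hA0 he)).2 h
  rw [natDegree_mul hA0 he] at h1
  exact ⟨_, eq_C_of_natDegree_eq_zero (by omega)⟩

open Polynomial in
/-- a pair with unique common root -/
lemma kernel_at {m n : ℕ} {A B p q : ℂ[X]} {z0 : ℂ} {α β : ℂ}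
    (hA : A.natDegree ≤ m) (hB : B.natDegree ≤ n)
    (hinf : A.coeff m ≠ 0 ∨ B.coeff n ≠ 0)
    (hA0 : A.eval z0 = 0) (hB0 : B.eval z0 = 0)
    (huniq : ∀ z, A.eval z = 0 → B.eval z = 0 → z = z0)
    (htr : α * (derivative B).eval z0 - β * (derivative A).eval z0 ≠ 0)
    (hp : p.degree < m) (hq : q.degree < n) (h0 : A * q + B * p = 0)
    (h1 : α * q.eval z0 + β * p.eval z0 = 0) : p = 0 ∧ q = 0 := by
  obtain ⟨a, rfl⟩ := dvd_iff_isRoot.2 hA0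
  obtain ⟨b, rfl⟩ := dvd_iff_isRoot.2 hB0
  have hda : (derivative ((X - C z0) * a)).eval z0 = a.eval z0 := by simp
  have hdb : (derivative ((X - C z0) * b)).eval z0 = b.eval z0 := by simp
  rw [hda, hdb] at htr
  have hc : IsCoprime a b := by
    apply isCoprime_of_dvd
    · rintro ⟨rfl, rfl⟩; simp at htr
    · intro z hz hz0 hza hzb
      obtain ⟨r, hr⟩ := Complex.exists_root (degree_pos_of_ne_zero_of_nonunit hz0 hz)
      have hra : a.eval r = 0 := by
        obtain ⟨c, rfl⟩ := hza; rw [eval_mul, hr.eq_zero, zero_mul]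
      have hrb : b.eval r = 0 := by
        obtain ⟨c, rfl⟩ := hzb; rw [eval_mul, hr.eq_zero, zero_mul]
      have := huniq r (by simp [hra]) (by simp [hrb])
      subst this
      rw [hra, hrb] at htr; simp at htr
  have h2 : a * q = - (b * p) := by
    have : (X - C z0) * (a * q + b * p) = 0 := by rw [← h0]; ring
    have := (mul_eq_zero.1 this).resolve_left (X_sub_C_ne_zero z0)
    linear_combination this
  have h3 : b ∣ q := by
    apply hc.symm.dvd_of_dvd_mul_left
    rw [h2]; exact (dvd_mul_right b p).neg_right
  obtain ⟨e, rfl⟩ := h3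
  have h4 : p = - (a * e) ∨ b = 0 := by
    by_cases hb : b = 0
    · right; exact hb
    left
    have : b * (a * e + p) = 0 := by linear_combination h2
    have := (mul_eq_zero.1 this).resolve_left hb
    linear_combination this
  rcases h4 with rfl | rfl
  · have hconst : ∃ c, e = C c := by
      rcases hinf with h | h
      · have ha0 : a ≠ 0 := by rintro rfl; simp at h
        have hm : ((X - C z0) * a).natDegree = m :=
          le_antisymm hA (le_natDegree_of_ne_zero h)
        rw [natDegree_mul (X_sub_C_ne_zero z0) ha0, natDegree_X_sub_C] at hm
        refine deg_mul_const (m := m - 1) (A := a) (by omega) ha0 ?_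
        rw [show m - 1 + 1 = m by omega]
        simpa using hp
      · have ha0 : b ≠ 0 := by rintro rfl; simp at h
        have hm : ((X - C z0) * b).natDegree = n :=
          le_antisymm hB (le_natDegree_of_ne_zero h)
        rw [natDegree_mul (X_sub_C_ne_zero z0) ha0, natDegree_X_sub_C] at hm
        refine deg_mul_const (m := n - 1) (A := b) (by omega) ha0 ?_
        rw [show n - 1 + 1 = n by omega]
        simpa using hq
    obtain ⟨c, rfl⟩ := hconst
    have : c * (α * b.eval z0 - β * a.eval z0) = 0 := by
      simp at h1; linear_combination h1
    rcases mul_eq_zero.1 this with rfl | h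
    · simp
    · exact absurd h htr
  · simp only [zero_mul, neg_zero, mul_zero] at *
    have ha : a.eval z0 ≠ 0 := by rintro h; simp [h] at htr
    have hβ : β ≠ 0 := by rintro h; simp [h] at htr
    simp [hβ] at h1
    have ha0 : a ≠ 0 := by rintro rfl; simp at ha
    have haC : a.natDegree = 0 := natDegree_eq_zero_of_isUnit (isCoprime_zero_right.1 hc)
    have hm : m ≤ 1 := by
      rcases hinf with h | h
      · have := (le_natDegree_of_ne_zero h)
        rw [natDegree_mul (X_sub_C_ne_zero z0) ha0, natDegree_X_sub_C] at this
        omega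
      · simp at h
    have : p.degree < 1 := lt_of_lt_of_le hp (by exact_mod_cast hm)
    have hpC : p = C (p.coeff 0) := eq_C_of_natDegree_eq_zero (natDegree_eq_zero_iff_degree_le_zero.2 (by
      by_cases h : p = 0
      · simp [h]
      · rw [degree_eq_natDegree h] at this ⊢
        norm_cast at this ⊢; omega))
    rw [hpC] at h1 ⊢
    simp at h1
    simp [h1]

open Polynomial in
lemma resultant_zero_iff' {m n : ℕ} {A B : ℂ[X]}
    (hA : A.natDegree ≤ m) (hB : B.natDegree ≤ n) (hmn : 0 < m + n)
    (hinf : A.coeff m ≠ 0 ∨ B.coeff n ≠ 0) :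
    resultant A B m n = 0 ↔ ∃ z, A.eval z = 0 ∧ B.eval z = 0 := by
  constructor
  · intro h
    obtain ⟨w, hw, hw2⟩ := Matrix.exists_mulVec_eq_zero_iff.2 h
    obtain ⟨p, q, hp, hq, hpq, H⟩ := syl_mulVec w
    have h0 : A * q + B * p = 0 := by
      have hd := syl_deg hp hq hA hB
      ext1
      rename_i k
      by_cases hk : k < m + n
      · have := H A B hA hB ⟨k, hk⟩
        rw [hw2] at this
        exact this.symm
      · rw [coeff_eq_zero_of_degree_lt]; · simp
        exact hd.trans_le (by exact_mod_cast not_lt.1 hk)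
    by_contra hno
    push Not at hno
    have hc : IsCoprime A B := by
      apply isCoprime_of_dvd
      · rintro ⟨rfl, rfl⟩; simp at hinf
      · intro z hz hz0 hza hzb
        obtain ⟨r, hr⟩ := Complex.exists_root (degree_pos_of_ne_zero_of_nonunit hz0 hz)
        have hra : A.eval r = 0 := by
          obtain ⟨c, rfl⟩ := hza; rw [eval_mul, hr.eq_zero, zero_mul]
        have hrb : B.eval r = 0 := by
          obtain ⟨c, rfl⟩ := hzb; rw [eval_mul, hr.eq_zero, zero_mul]
        exact hno r hra hrb
    have h1 : B ∣ q := by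
      apply hc.symm.dvd_of_dvd_mul_left
      rw [show A * q = -(B * p) by linear_combination h0]
      exact (dvd_mul_right B p).neg_right
    have h2 : A ∣ p := by
      apply hc.dvd_of_dvd_mul_left
      rw [show B * p = -(A * q) by linear_combination h0]
      exact (dvd_mul_right A q).neg_right
    apply hw
    rcases hinf with h | h
    · have hm : A.natDegree = m := le_antisymm hA (le_natDegree_of_ne_zero h)
      have hA0 : A ≠ 0 := by rintro rfl; simp at h
      have hp0 : p = 0 := eq_zero_of_dvd_of_degree_lt h2 (by rwa [degree_eq_natDegree hA0, hm])
      refine hpq hp0 ?_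
      rw [hp0] at h0
      simpa [hA0] using h0
    · have hm : B.natDegree = n := le_antisymm hB (le_natDegree_of_ne_zero h)
      have hA0 : B ≠ 0 := by rintro rfl; simp at h
      have hp0 : q = 0 := eq_zero_of_dvd_of_degree_lt h1 (by rwa [degree_eq_natDegree hA0, hm])
      refine hpq ?_ hp0
      rw [hp0] at h0
      simpa [hA0] using h0
  · rintro ⟨z, hza, hzb⟩
    obtain ⟨p, q, -, -, h⟩ := exists_mul_add_mul_eq_C_resultant A B hA hB (by omega)
    have := congrArg (eval z) h
    simp [hza, hzb] at this
    exact this.symm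

open Polynomial in
lemma syl_map_derivative {m n : ℕ} (A B : ℂ[X][X]) (u0 : ℂ) (i j) :
    (derivative (sylvester A B m n i j)).eval u0 =
      sylvester (atU u0 (dU A)) (atU u0 (dU B)) m n i j := by
  induction j using Fin.addCases <;>
  · simp only [sylvester, Matrix.of_apply, Fin.addCases_left, Fin.addCases_right]
    split_ifs <;> simp [dU_coeff, atU]

open Polynomial in
lemma simple_root {m n : ℕ} (A B : ℂ[X][X]) (hA : A.natDegree ≤ m) (hB : B.natDegree ≤ n)
    (hmn : 0 < m + n) (u0 z0 : ℂ)
    (hinf : (atU u0 A).coeff m ≠ 0 ∨ (atU u0 B).coeff n ≠ 0)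
    (hA0 : (atU u0 A).eval z0 = 0) (hB0 : (atU u0 B).eval z0 = 0)
    (huniq : ∀ z, (atU u0 A).eval z = 0 → (atU u0 B).eval z = 0 → z = z0)
    (htr : (atU u0 (dU A)).eval z0 * (derivative (atU u0 B)).eval z0 -
      (atU u0 (dU B)).eval z0 * (derivative (atU u0 A)).eval z0 ≠ 0) :
    ¬ (X - C u0) ^ 2 ∣ resultant A B m n := by
  intro hd
  have hAu : (atU u0 A).natDegree ≤ m := natDegree_map_le.trans hA
  have hBu : (atU u0 B).natDegree ≤ n := natDegree_map_le.trans hB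
  have hAu' : (atU u0 (dU A)).natDegree ≤ m := natDegree_map_le.trans (dU_natDegree hA)
  have hBu' : (atU u0 (dU B)).natDegree ≤ n := natDegree_map_le.trans (dU_natDegree hB)
  have key : ∀ (f g : ℂ[X]), f.natDegree ≤ m → g.natDegree ≤ n → f.eval z0 = 0 → g.eval z0 = 0 →
      ∀ w : Fin (m + n) → ℂ, ∑ j, (∑ i : Fin (m + n), z0 ^ (i : ℕ) * sylvester f g m n i j) * w j = 0 := by
    intro f g hf hg hf0 hg0 w
    obtain ⟨p, q, hp, hq, hpq, H⟩ := syl_mulVec w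
    have h1 : ∑ i : Fin (m+n), z0 ^ (i : ℕ) * (Matrix.mulVec (sylvester f g m n) w) i = 0 := by
      rw [Finset.sum_congr rfl (fun i _ => by rw [H f g hf hg i]),
        sum_coeff_eval _ (syl_deg hp hq hf hg)]
      simp [hf0, hg0]
    rw [← h1]
    simp only [Matrix.mulVec, dotProduct, Finset.mul_sum, Finset.sum_mul]
    rw [Finset.sum_comm]
    simp only [mul_assoc]
  have hmap : (sylvester A B m n).map (eval u0) = sylvester (atU u0 A) (atU u0 B) m n := by
    rw [sylvester_map_map]; rfl
  obtain ⟨w, hw, hw2, hw3⟩ := double_root_det (sylvester A B m n) (fun i => z0 ^ (i : ℕ))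
    ⟨0, hmn⟩ (by simp) u0 (by
      intro j
      have := key _ _ hAu hBu hA0 hB0 (Pi.single j 1)
      simp only [Pi.single_apply, mul_ite, mul_one, mul_zero, Finset.sum_ite_eq', Finset.mem_univ, if_true] at this
      rw [← hmap] at this
      simpa [eval_finsetSum] using this) hd
  rw [hmap] at hw2
  obtain ⟨p, q, hp, hq, hpq, H⟩ := syl_mulVec w
  have h0 : atU u0 A * q + atU u0 B * p = 0 := by
    have hd := syl_deg hp hq hAu hBu
    ext1
    rename_i k
    by_cases hk : k < m + n
    · have := H _ _ hAu hBu ⟨k, hk⟩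
      rw [hw2] at this
      exact this.symm
    · rw [coeff_eq_zero_of_degree_lt]; · simp
      exact hd.trans_le (by exact_mod_cast not_lt.1 hk)
  have h1 : (atU u0 (dU A)).eval z0 * q.eval z0 + (atU u0 (dU B)).eval z0 * p.eval z0 = 0 := by
    have h2 : ∑ i : Fin (m+n), z0 ^ (i : ℕ) *
        (Matrix.mulVec (sylvester (atU u0 (dU A)) (atU u0 (dU B)) m n) w) i = 0 := by
      rw [← hw3]
      simp only [Matrix.mulVec, dotProduct, Finset.mul_sum, derivative_sum, eval_finsetSum, Finset.sum_mul]
      rw [Finset.sum_comm]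
      refine Finset.sum_congr rfl fun j _ => Finset.sum_congr rfl fun i _ => ?_
      rw [derivative_C_mul, eval_mul, eval_C, syl_map_derivative, mul_assoc]
    rw [Finset.sum_congr rfl (fun i _ => by rw [H _ _ hAu' hBu' i]),
        sum_coeff_eval _ (syl_deg hp hq hAu' hBu')] at h2
    simpa using h2
  obtain ⟨hp0, hq0⟩ := kernel_at hAu hBu hinf hA0 hB0 huniq htr hp hq h0 h1
  exact hw (hpq hp0 hq0)

open Polynomial in
/-- The counting lemma. -/
lemma count_common {m n N : ℕ} (A B : ℂ[X][X]) (hA : A.natDegree ≤ m) (hB : B.natDegree ≤ n)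
    (hmn : 0 < m + n) (hN : (resultant A B m n).natDegree = N) (hR : resultant A B m n ≠ 0)
    (hinf : ∀ u0, (atU u0 A).coeff m ≠ 0 ∨ (atU u0 B).coeff n ≠ 0)
    (huniq : ∀ u0 z z', (atU u0 A).eval z = 0 → (atU u0 B).eval z = 0 →
      (atU u0 A).eval z' = 0 → (atU u0 B).eval z' = 0 → z = z')
    (htr : ∀ u0 z0, (atU u0 A).eval z0 = 0 → (atU u0 B).eval z0 = 0 →
      (atU u0 (dU A)).eval z0 * (derivative (atU u0 B)).eval z0 -
      (atU u0 (dU B)).eval z0 * (derivative (atU u0 A)).eval z0 ≠ 0) :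
    ∃ S : Finset ℂ, S.card = N ∧ ∀ u, u ∈ S ↔ ∃ z, (atU u A).eval z = 0 ∧ (atU u B).eval z = 0 := by
  classical
  set R := resultant A B m n with hRdef
  have hroot : ∀ u, R.eval u = 0 ↔ ∃ z, (atU u A).eval z = 0 ∧ (atU u B).eval z = 0 := by
    intro u
    rw [← resultant_zero_iff' (m := m) (n := n) (natDegree_map_le.trans hA) (natDegree_map_le.trans hB) hmn (hinf u),
      resultant_map_map]
    rfl
  refine ⟨R.roots.toFinset, ?_, ?_⟩
  · rw [Multiset.toFinset_card_of_nodup, IsAlgClosed.card_roots_eq_natDegree, hN]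
    rw [Multiset.nodup_iff_count_le_one]
    intro u
    rw [count_roots]
    by_contra! h
    have hd : (X - C u) ^ 2 ∣ R := (pow_dvd_pow _ h).trans (pow_rootMultiplicity_dvd R u)
    have hu : R.eval u = 0 := by
      apply dvd_iff_isRoot.1 ((dvd_pow_self _ two_ne_zero).trans hd)
    obtain ⟨z, hz1, hz2⟩ := (hroot u).1 hu
    exact simple_root A B hA hB hmn u z (hinf u) hz1 hz2
      (fun z' h1 h2 => huniq u _ _ h1 h2 hz1 hz2) (htr u z hz1 hz2) hd
  · intro u
    rw [Multiset.mem_toFinset, mem_roots hR, IsRoot, hroot]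


open Polynomial in
lemma coeff_comp_scale (A : ℂ[X]) (c : ℂ) (k : ℕ) :
    (A.comp (C c * X)).coeff k = A.coeff k * c ^ k := by
  rw [comp_C_mul_X_coeff]

open Polynomial in
lemma res_scale (A B : ℂ[X]) (m n : ℕ) (c : ℂ) (hc : c ≠ 0) :
    resultant (A.comp (C c * X)) (B.comp (C c * X)) m n = c ^ (m * n) * resultant A B m n := by
  let e : Fin (m + n) → ℂ := fun j => j.addCases (fun j₁ => c ^ (j₁ : ℕ)) (fun j₁ => c ^ (j₁ : ℕ))
  have h : sylvester (A.comp (C c * X)) (B.comp (C c * X)) m n * Matrix.diagonal e =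
      Matrix.diagonal (fun i : Fin (m + n) => c ^ (i : ℕ)) * sylvester A B m n := by
    ext i j
    rw [Matrix.mul_diagonal, Matrix.diagonal_mul]
    induction j using Fin.addCases <;>
    · simp only [sylvester, Matrix.of_apply, Fin.addCases_left, Fin.addCases_right, e]
      split_ifs with h
      · rw [coeff_comp_scale, mul_assoc, ← pow_add, Nat.sub_add_cancel h.1, mul_comm]
      · simp
  have h2 := congrArg Matrix.det h
  rw [Matrix.det_mul, Matrix.det_mul, Matrix.det_diagonal, Matrix.det_diagonal] at h2
  have h3 : ∏ j, e j = c ^ (∑ i ∈ Finset.range m, i + ∑ i ∈ Finset.range n, i) := by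
    rw [Fin.prod_univ_add]
    simp only [e, Fin.addCases_left, Fin.addCases_right]
    rw [Finset.prod_pow_eq_pow_sum, Finset.prod_pow_eq_pow_sum, pow_add,
      Fin.sum_univ_eq_sum_range (fun i => i), Fin.sum_univ_eq_sum_range (fun i => i)]
  have h4 : ∏ i : Fin (m + n), c ^ (i : ℕ) =
      c ^ (∑ i ∈ Finset.range m, i + ∑ i ∈ Finset.range n, i) * c ^ (m * n) := by
    rw [Finset.prod_pow_eq_pow_sum, Fin.sum_univ_eq_sum_range (fun i => i), ← pow_add]
    congr 1
    rw [Finset.sum_range_add, Finset.sum_add_distrib]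
    simp; ring
  rw [h3, h4] at h2
  have h5 : c ^ (∑ i ∈ Finset.range m, i + ∑ i ∈ Finset.range n, i) ≠ 0 := pow_ne_zero _ hc
  apply mul_left_cancel₀ h5
  rw [resultant, resultant]
  linear_combination h2

open Polynomial in
lemma natDegree_of_infty (R RI : ℂ[X]) (N : ℕ) (h : ∀ v : ℂ, v ≠ 0 → RI.eval v = v ^ N * R.eval v⁻¹)
    (h0 : RI.eval 0 ≠ 0) : R ≠ 0 ∧ R.natDegree = N := by
  have hinf : {v : ℂ | v ≠ 0}.Infinite := by
    have : {v : ℂ | v ≠ 0} = {0}ᶜ := rfl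
    rw [this]; exact (Set.finite_singleton 0).infinite_compl
  have key : X ^ R.natDegree * RI = X ^ N * R.reverse := by
    apply eq_of_infinite_eval_eq
    apply hinf.mono
    intro v hv
    have hv' : v ≠ 0 := hv
    simp only [Set.mem_ofPred_eq, eval_mul, eval_pow, eval_X, h v hv']
    have := invertibleOfNonzero (inv_ne_zero hv')
    have := eval₂_reverse_mul_pow (RingHom.id ℂ) v⁻¹ R
    rw [invOf_eq_inv, inv_inv] at this
    change R.reverse.eval v * _ = R.eval _ at this
    rw [← this]
    have h2 : v ^ R.natDegree * v⁻¹ ^ R.natDegree = 1 := by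
      rw [← mul_pow, mul_inv_cancel₀ hv', one_pow]
    linear_combination (v ^ N * R.reverse.eval v) * h2
  have hR : R ≠ 0 := by
    rintro rfl
    simp at key
    rw [key] at h0
    simp at h0
  refine ⟨hR, ?_⟩
  have hr0 : R.reverse.eval 0 ≠ 0 := by
    rw [← coeff_zero_eq_eval_zero, coeff_zero_reverse]; simpa using hR
  rcases lt_trichotomy R.natDegree N with hlt | heq | hgt
  · exfalso
    obtain ⟨k, rfl⟩ := Nat.exists_eq_add_of_lt hlt
    rw [show R.natDegree + k + 1 = R.natDegree + (k + 1) by ring, pow_add, mul_assoc] at key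
    have := mul_left_cancel₀ (pow_ne_zero _ X_ne_zero) key
    rw [this] at h0; simp at h0
  · exact heq
  · exfalso
    obtain ⟨k, hk⟩ := Nat.exists_eq_add_of_lt hgt
    rw [hk, show N + k + 1 = N + (k + 1) by ring, pow_add, mul_assoc] at key
    have := mul_left_cancel₀ (pow_ne_zero _ X_ne_zero) key
    rw [← this] at hr0; simp at hr0


open Polynomial in
/-- the Wronskian -/
noncomputable def JJ {R : Type*} [CommRing R] (f g : R[X]) : R[X] := f * derivative g - derivative f * g

open Polynomial in
def fam1 (d : ℕ) (f g : ℂ[X]) : Prop := ∃ (a b : ℂ) (p q : ℂ[X]), p.degree < (d - 1 : ℕ) ∧ q.degree < (d - 1 : ℕ) ∧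
  f = (X - C a) * (X - C b) * p ∧ g = (X - C a) * (X - C b) * q
open Polynomial in
def fam2 (d : ℕ) (f g : ℂ[X]) : Prop := ∃ (a b c : ℂ) (p q : ℂ[X]), p.degree < (d - 3 : ℕ) ∧ q.degree < d ∧
  f = C c * g + (X - C a) * (X - C b) ^ 3 * p ∧ g = (X - C a) * q
open Polynomial in
def fam3 (d : ℕ) (f g : ℂ[X]) : Prop := ∃ (a c : ℂ) (p q : ℂ[X]), p.degree < (d - 2 : ℕ) ∧ q.degree < d ∧
  f = C c * g + (X - C a) ^ 3 * p ∧ g = (X - C a) * q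
open Polynomial in
def fam4 (d : ℕ) (f g : ℂ[X]) : Prop := ∃ (a b β γ : ℂ) (p q : ℂ[X]), p.degree < (d - 2 : ℕ) ∧ q.degree < (d - 2 : ℕ) ∧
  f = (X - C a) ^ 3 * p + C β * ((X - C b) ^ 3 * q) ∧ g = C γ * ((X - C a) ^ 3 * p) + (X - C b) ^ 3 * q
open Polynomial in
def fam5 (d : ℕ) (f g : ℂ[X]) : Prop := 4 ≤ d ∧ ∃ (a b c : ℂ) (p : ℂ[X]), p.degree < (d - 5 : ℕ) ∧ g.degree < (d + 1 : ℕ) ∧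
  f = C c * g + (X - C a) ^ 3 * (X - C b) ^ 3 * p
open Polynomial in
def fam6 (d : ℕ) (f g : ℂ[X]) : Prop := ∃ (a c : ℂ) (p : ℂ[X]), p.degree < (d - 3 : ℕ) ∧ g.degree < (d + 1 : ℕ) ∧
  f = C c * g + (X - C a) ^ 4 * p
open Polynomial in
def fam7 (d : ℕ) (f g : ℂ[X]) : Prop := f.degree < d ∧ g.degree < d
open Polynomial in
def fam8 (d : ℕ) (f g : ℂ[X]) : Prop := ∃ (c : ℂ) (p : ℂ[X]), p.degree < (d - 2 : ℕ) ∧ g.degree < (d + 1 : ℕ) ∧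
  f = C c * g + p
open Polynomial in
def fam9 (d : ℕ) (f g f1 g1 : ℂ[X]) : Prop := ∃ (a c α e0 e1 : ℂ) (p q r : ℂ[X]),
  p.degree < (d - 2 : ℕ) ∧ q.degree < (d - 1 : ℕ) ∧ r.degree < (d - 2 : ℕ) ∧ g1.degree < d ∧
  g = C e0 + C e1 * (X - C a) + (X - C a) ^ 2 * q ∧
  f = C c * g + (X - C a) ^ 3 * p ∧
  f1 = C c * g1 + C α * (C e0 + C e1 * (X - C a)) + (X - C a) ^ 2 * r
open Polynomial in
def fam10 (d : ℕ) (f g f1 g1 : ℂ[X]) : Prop := ∃ (a c : ℂ) (p q r : ℂ[X]),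
  p.degree < (d - 1 : ℕ) ∧ q.degree < d ∧ r.degree < (d - 1 : ℕ) ∧ g1.degree < d ∧
  g = (X - C a) * q ∧
  f = C c * g + (X - C a) ^ 2 * p ∧
  f1 = C c * g1 + (X - C a) * r
open Polynomial in
def fam11 (d : ℕ) (f g : ℂ[X]) : Prop := ∃ (a : ℂ) (p q : ℂ[X]), p.degree < d ∧ q.degree < d ∧
  f = (X - C a) * p ∧ g = (X - C a) * q
open Polynomial in
def fam12 (d : ℕ) (f g : ℂ[X]) : Prop := ∃ (a c : ℂ) (p : ℂ[X]), p.degree < (d - 2 : ℕ) ∧ g.degree < (d + 1 : ℕ) ∧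
  f = C c * g + (X - C a) ^ 3 * p

open Polynomial in
def BadQ (d : ℕ) (f g f1 g1 : ℂ[X]) : Prop :=
  fam1 d f g ∨ fam2 d f g ∨ fam3 d f g ∨ fam4 d f g ∨ fam5 d f g ∨ fam6 d f g ∨ fam7 d f g ∨ fam8 d f g ∨
  fam9 d f g f1 g1 ∨ fam10 d f g f1 g1

open Polynomial in
def BadI (d : ℕ) (f g : ℂ[X]) : Prop :=
  fam7 d f g ∨ fam8 d f g ∨ fam11 d f g ∨ fam12 d f g

open Polynomial in
structure GoodU (d : ℕ) (f g f1 g1 : ℂ[X]) : Prop where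
  base_uniq : ∀ a b, f.eval a = 0 → g.eval a = 0 → f.eval b = 0 → g.eval b = 0 → a = b
  base_tr : ∀ a, f.eval a = 0 → g.eval a = 0 →
    f1.eval a * (derivative g).eval a - g1.eval a * (derivative f).eval a ≠ 0
  base_inf : f.coeff d ≠ 0 ∨ g.coeff d ≠ 0
  J_uniq : ∀ a b, (JJ f g).eval a = 0 → (derivative (JJ f g)).eval a = 0 →
    (JJ f g).eval b = 0 → (derivative (JJ f g)).eval b = 0 → a = b
  J_u : ∀ a, (JJ f g).eval a = 0 → (derivative (JJ f g)).eval a = 0 →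
    (JJ f1 g).eval a + (JJ f g1).eval a ≠ 0
  J_zz : ∀ a, (JJ f g).eval a = 0 → (derivative (JJ f g)).eval a = 0 →
    (derivative (derivative (JJ f g))).eval a ≠ 0
  J_inf : (JJ f g).coeff (2 * d - 2) ≠ 0 ∨ (JJ f g).coeff (2 * d - 3) ≠ 0

open Polynomial in
structure GoodI (d : ℕ) (f g : ℂ[X]) : Prop where
  base : ∀ a, f.eval a = 0 → g.eval a = 0 → False
  base_inf : f.coeff d ≠ 0 ∨ g.coeff d ≠ 0
  J : ∀ a, (JJ f g).eval a = 0 → (derivative (JJ f g)).eval a = 0 → False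
  J_inf : (JJ f g).coeff (2 * d - 2) ≠ 0 ∨ (JJ f g).coeff (2 * d - 3) ≠ 0

open Polynomial in
lemma JJ_swap {R : Type*} [CommRing R] (f g : R[X]) : JJ g f = - JJ f g := by unfold JJ; ring

open Polynomial in
lemma deg_quot {f p s : ℂ[X]} {m k n : ℕ} (hf : f.degree < n) (hs : s.Monic) (hsd : s.natDegree = m)
    (h : f = s * p) (hn : n ≤ m + k) : p.degree < k := by
  by_cases hp : p = 0
  · simp [hp]
  have hf0 : f ≠ 0 := by rw [h]; exact mul_ne_zero hs.ne_zero hp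
  rw [← natDegree_lt_iff_degree_lt hp]
  rw [← natDegree_lt_iff_degree_lt hf0, h, natDegree_mul hs.ne_zero hp] at hf
  omega

open Polynomial in
lemma dvd1 (h : ℂ[X]) (a : ℂ) (h0 : h.eval a = 0) : ∃ p, h = (X - C a) * p := dvd_iff_isRoot.2 h0

open Polynomial in
lemma dvd2 (h : ℂ[X]) (a : ℂ) (h0 : h.eval a = 0) (h1 : (derivative h).eval a = 0) :
    ∃ p, h = (X - C a) ^ 2 * p := by
  obtain ⟨p, rfl⟩ := dvd1 h a h0
  simp at h1
  obtain ⟨q, rfl⟩ := dvd1 p a h1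
  exact ⟨q, by ring⟩

open Polynomial in
lemma dvd3 (h : ℂ[X]) (a : ℂ) (h0 : h.eval a = 0) (h1 : (derivative h).eval a = 0)
    (h2 : (derivative (derivative h)).eval a = 0) : ∃ p, h = (X - C a) ^ 3 * p := by
  obtain ⟨p, rfl⟩ := dvd2 h a h0 h1
  simp [derivative_pow] at h2
  obtain ⟨q, rfl⟩ := dvd1 p a h2
  exact ⟨q, by ring⟩

open Polynomial in
lemma JJ_der (f g : ℂ[X]) : derivative (JJ f g) = f * derivative (derivative g) - derivative (derivative f) * g := by
  unfold JJ; simp; ring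

open Polynomial in
/-- flex with respect to the chart `f = c g + ...` -/
lemma flexA {f g : ℂ[X]} {a : ℂ} (hg : g.eval a ≠ 0) (h : (JJ f g).eval a = 0)
    (h' : (derivative (JJ f g)).eval a = 0) : ∃ c p, f = C c * g + (X - C a) ^ 3 * p := by
  rw [JJ_der] at h'
  unfold JJ at h
  simp at h h'
  obtain ⟨p, hp⟩ := dvd3 (f - C (f.eval a / g.eval a) * g) a (by simp [hg])
    (by simp; field_simp; linear_combination -h) (by simp; field_simp; linear_combination -h')
  exact ⟨_, p, by rw [← hp]; ring⟩

open Polynomial in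
lemma flex_deg {d : ℕ} (hd : 3 ≤ d) {f g s p : ℂ[X]} {c : ℂ} {m k : ℕ} (hf : f.degree < (d + 1 : ℕ)) (hg : g.degree < (d + 1 : ℕ))
   (hs : s.Monic) (hsd : s.natDegree = m) (hk : d + 1 ≤ m + k) (h : f = C c * g + s * p) : p.degree < k := by
  refine deg_quot (f := f - C c * g) (n := d + 1) (s := s) ?_ hs hsd (by rw [h]; ring) hk
  refine lt_of_le_of_lt (degree_sub_le _ _) (max_lt hf ?_)
  refine lt_of_le_of_lt (by rw [C_mul']; exact degree_smul_le _ _) hg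

open Polynomial in
lemma swap4 {d : ℕ} {f g : ℂ[X]} (h : fam4 d g f) : fam4 d f g := by
  obtain ⟨a, b, β, γ, p, q, hp, hq, h1, h2⟩ := h
  exact ⟨b, a, γ, β, q, p, hq, hp, by rw [h2]; ring, by rw [h1]; ring⟩

open Polynomial in
lemma C_mul_deg {p : ℂ[X]} {k : ℕ} (c : ℂ) (h : p.degree < k) : (C c * p).degree < k :=
  lt_of_le_of_lt (by rw [C_mul']; exact degree_smul_le _ _) h

open Polynomial in
lemma flexAA {d : ℕ} (hd : 3 ≤ d) {f g : ℂ[X]} {a b : ℂ} (hab : a ≠ b)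
    (hf : f.degree < (d + 1 : ℕ)) (hg : g.degree < (d + 1 : ℕ)) {c c' : ℂ} {p p' : ℂ[X]}
    (h : f = C c * g + (X - C a) ^ 3 * p) (h' : f = C c' * g + (X - C b) ^ 3 * p') :
    fam4 d f g ∨ fam5 d f g ∨ fam6 d f g := by
  have hp : p.degree < (d - 2 : ℕ) := flex_deg hd hf hg ((monic_X_sub_C a).pow 3) (m := 3) (by simp) (by omega) h
  have hp' : p'.degree < (d - 2 : ℕ) := flex_deg hd hf hg ((monic_X_sub_C b).pow 3) (m := 3) (by simp) (by omega) h'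
  by_cases hc : c = c'
  · right
    subst hc
    have h3 : (X - C a) ^ 3 * p = (X - C b) ^ 3 * p' := by linear_combination h' - h
    have hco : IsCoprime ((X - C b) ^ 3) ((X - C a) ^ 3) :=
      (isCoprime_X_sub_C_of_isUnit_sub (by simpa [sub_eq_zero] using hab.symm)).pow
    obtain ⟨r, rfl⟩ := hco.dvd_of_dvd_mul_left (Dvd.intro _ h3.symm)
    by_cases hr : r = 0
    · right
      subst hr
      exact ⟨a, c, 0, by simp, hg, by rw [h]; ring⟩
    · left
      have hs : ((X - C a) ^ 3 * (X - C b) ^ 3 : ℂ[X]).Monic := ((monic_X_sub_C a).pow 3).mul ((monic_X_sub_C b).pow 3)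
      have hsd : ((X - C a) ^ 3 * (X - C b) ^ 3 : ℂ[X]).natDegree = 6 := by
        rw [Monic.natDegree_mul ((monic_X_sub_C a).pow 3) ((monic_X_sub_C b).pow 3)]; simp
      have h5 : d ≥ 4 := by
        by_contra hlt
        have := (natDegree_lt_iff_degree_lt (mul_ne_zero (pow_ne_zero 3 (X_sub_C_ne_zero b)) hr)).2 hp
        rw [natDegree_mul (pow_ne_zero 3 (X_sub_C_ne_zero b)) hr] at this
        simp at this
        omega
      exact ⟨h5, a, b, c, r, flex_deg hd hf hg hs hsd (by omega) (by rw [h]; ring), hg, by rw [h]; ring⟩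
  · left
    have hcc : c' - c ≠ 0 := fun h => hc (sub_eq_zero.1 h).symm
    set k := (c' - c)⁻¹ with hk
    have hkk : C k * (C c' - C c) = (1 : ℂ[X]) := by rw [← C_sub, ← C_mul, hk, inv_mul_cancel₀ hcc, C_1]
    by_cases hc' : c' = 0
    · subst hc'
      have hc0 : c ≠ 0 := hc
      have hi : C c⁻¹ * C c = (1 : ℂ[X]) := by rw [← C_mul, inv_mul_cancel₀ hc0, C_1]
      -- roles exchanged
      refine ⟨b, a, 0, c⁻¹, p', C (-c⁻¹) * p, hp', C_mul_deg _ hp, ?_, ?_⟩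
      · rw [h']; simp
      · simp only [C_0, zero_mul, zero_add] at h'
        simp only [C_neg]
        rw [← h']
        linear_combination -C c⁻¹ * h - g * hi
    · have hi : C c'⁻¹ * C c' = (1 : ℂ[X]) := by rw [← C_mul, inv_mul_cancel₀ hc', C_1]
      refine ⟨a, b, c, c'⁻¹, C (c' * k) * p, C (-k) * p', C_mul_deg _ hp, C_mul_deg _ hp', ?_, ?_⟩
      · simp only [C_mul, C_neg]
        linear_combination (- f) * hkk + C c' * C k * h - C c * C k * h'
      · simp only [C_mul, C_neg]
        linear_combination (- g) * hkk + C k * h - C k * h' - C k * ((X - C a) ^ 3 * p) * hi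


open Polynomial in
lemma flex_cases {f g : ℂ[X]} {a : ℂ} (h : (JJ f g).eval a = 0)
    (h' : (derivative (JJ f g)).eval a = 0) : (f.eval a = 0 ∧ g.eval a = 0) ∨
    (g.eval a ≠ 0 ∧ ∃ c p, f = C c * g + (X - C a) ^ 3 * p) ∨
    (f.eval a ≠ 0 ∧ ∃ c p, g = C c * f + (X - C a) ^ 3 * p) := by
  by_cases hg : g.eval a = 0
  · by_cases hf : f.eval a = 0
    · exact Or.inl ⟨hf, hg⟩
    · refine Or.inr (Or.inr ⟨hf, flexA hf ?_ ?_⟩)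
      · rw [JJ_swap]; simpa using h
      · rw [JJ_swap]; simpa using h'
  · exact Or.inr (Or.inl ⟨hg, flexA hg h h'⟩)

open Polynomial in
lemma base_base {d : ℕ} (hd : 3 ≤ d) {f g : ℂ[X]} {a b : ℂ} (hab : a ≠ b)
    (hf : f.degree < (d + 1 : ℕ)) (hg : g.degree < (d + 1 : ℕ))
    (h1 : f.eval a = 0) (h2 : g.eval a = 0) (h3 : f.eval b = 0) (h4 : g.eval b = 0) : fam1 d f g := by
  have key : ∀ f : ℂ[X], f.degree < (d + 1 : ℕ) → f.eval a = 0 → f.eval b = 0 →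
      ∃ p : ℂ[X], p.degree < (d - 1 : ℕ) ∧ f = (X - C a) * (X - C b) * p := by
    intro f hf h1 h3
    obtain ⟨p, hp⟩ := dvd1 f a h1
    have : p.eval b = 0 := by
      rw [hp] at h3; simp [sub_eq_zero] at h3
      exact h3.resolve_left (fun h => hab h.symm)
    obtain ⟨q, hq⟩ := dvd1 p b this
    have he : f = (X - C a) * (X - C b) * q := by rw [hp, hq]; ring
    refine ⟨q, deg_quot hf ((monic_X_sub_C a).mul (monic_X_sub_C b)) (m := 2) ?_ he (by omega), he⟩
    rw [Monic.natDegree_mul (monic_X_sub_C a) (monic_X_sub_C b)]; simp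
  obtain ⟨p, hp, hp'⟩ := key f hf h1 h3
  obtain ⟨q, hq, hq'⟩ := key g hg h2 h4
  exact ⟨a, b, p, q, hp, hq, hp', hq'⟩

open Polynomial in
lemma base_double {d : ℕ} (hd : 3 ≤ d) {f g : ℂ[X]} {a : ℂ}
    (hf : f.degree < (d + 1 : ℕ)) (hg : g.degree < (d + 1 : ℕ))
    (h1 : f.eval a = 0) (h2 : g.eval a = 0) (h3 : (derivative f).eval a = 0) (h4 : (derivative g).eval a = 0) : fam1 d f g := by
  have key : ∀ f : ℂ[X], f.degree < (d + 1 : ℕ) → f.eval a = 0 → (derivative f).eval a = 0 →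
      ∃ p : ℂ[X], p.degree < (d - 1 : ℕ) ∧ f = (X - C a) * (X - C a) * p := by
    intro f hf h1 h3
    obtain ⟨q, hq⟩ := dvd2 f a h1 h3
    have he : f = (X - C a) * (X - C a) * q := by rw [hq]; ring
    refine ⟨q, deg_quot hf ((monic_X_sub_C a).mul (monic_X_sub_C a)) (m := 2) ?_ he (by omega), he⟩
    rw [Monic.natDegree_mul (monic_X_sub_C a) (monic_X_sub_C a)]; simp
  obtain ⟨p, hp, hp'⟩ := key f hf h1 h3
  obtain ⟨q, hq, hq'⟩ := key g hg h2 h4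
  exact ⟨a, a, p, q, hp, hq, hp', hq'⟩

open Polynomial in
lemma base_flex {d : ℕ} (hd : 3 ≤ d) {f g : ℂ[X]} {a b : ℂ} (hab : a ≠ b)
    (hf : f.degree < (d + 1 : ℕ)) (hg : g.degree < (d + 1 : ℕ))
    (h1 : f.eval a = 0) (h2 : g.eval a = 0) {c : ℂ} {p : ℂ[X]}
    (h : f = C c * g + (X - C b) ^ 3 * p) : fam2 d f g := by
  obtain ⟨q, hq⟩ := dvd1 g a h2
  have h3 : p.eval a = 0 := by
    have := congrArg (eval a) h
    simp [h1, h2, sub_eq_zero] at this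
    exact this.resolve_left hab
  obtain ⟨r, hr⟩ := dvd1 p a h3
  have he : f = C c * g + (X - C a) * (X - C b) ^ 3 * r := by rw [h, hr]; ring
  refine ⟨a, b, c, r, q, flex_deg hd hf hg ((monic_X_sub_C a).mul ((monic_X_sub_C b).pow 3)) (m := 4) ?_ (by omega) he,
    deg_quot hg (monic_X_sub_C a) (m := 1) (by simp) hq (by omega), he, hq⟩
  rw [Monic.natDegree_mul (monic_X_sub_C a) ((monic_X_sub_C b).pow 3)]; simp

open Polynomial in
lemma flexAB {d : ℕ} (hd : 3 ≤ d) {f g : ℂ[X]} {a b : ℂ} (hab : a ≠ b)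
    (hf : f.degree < (d + 1 : ℕ)) (hg : g.degree < (d + 1 : ℕ)) {c c' : ℂ} {p p' : ℂ[X]}
    (h : f = C c * g + (X - C a) ^ 3 * p) (h' : g = C c' * f + (X - C b) ^ 3 * p') :
    fam4 d f g ∨ fam5 d f g ∨ fam6 d f g := by
  by_cases hc : c * c' = 1
  · have hc1 : C c * C c' = (1 : ℂ[X]) := by rw [← C_mul, hc, C_1]
    refine flexAA hd hab hf hg h (c' := c) (p' := C (-c) * p') ?_
    simp only [C_neg]
    linear_combination (-C c) * h' - f * hc1
  · left
    have hp : p.degree < (d - 2 : ℕ) := flex_deg hd hf hg ((monic_X_sub_C a).pow 3) (m := 3) (by simp) (by omega) h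
    have hp' : p'.degree < (d - 2 : ℕ) := flex_deg hd hg hf ((monic_X_sub_C b).pow 3) (m := 3) (by simp) (by omega) h'
    have hk0 : 1 - c * c' ≠ 0 := fun h => hc (sub_eq_zero.1 h).symm
    have hk : C (1 - c * c')⁻¹ * (1 - C c * C c') = (1 : ℂ[X]) := by
      rw [← C_mul, ← C_1, ← C_sub, ← C_mul, inv_mul_cancel₀ hk0]
    set k := (1 - c * c')⁻¹
    refine ⟨a, b, c, c', C k * p, C k * p', C_mul_deg _ hp, C_mul_deg _ hp', ?_, ?_⟩
    · linear_combination (-f) * hk + C k * h + C k * C c * h'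
    · linear_combination (-g) * hk + C k * C c' * h + C k * h'

open Polynomial in
lemma J_uniq_bad {d : ℕ} (hd : 3 ≤ d) {f g f1 g1 : ℂ[X]} {a b : ℂ} (hab : a ≠ b)
    (hf : f.degree < (d + 1 : ℕ)) (hg : g.degree < (d + 1 : ℕ))
    (h1 : (JJ f g).eval a = 0) (h2 : (derivative (JJ f g)).eval a = 0)
    (h3 : (JJ f g).eval b = 0) (h4 : (derivative (JJ f g)).eval b = 0) :
    BadQ d f g f1 g1 ∨ BadQ d g f g1 f1 := by
  unfold BadQ
  rcases flex_cases h1 h2 with ⟨ha, ha'⟩ | ⟨-, c, p, ha⟩ | ⟨-, c, p, ha⟩ <;>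
  rcases flex_cases h3 h4 with ⟨hb, hb'⟩ | ⟨-, c', p', hb⟩ | ⟨-, c', p', hb⟩
  · have := base_base hd hab hf hg ha ha' hb hb'; simp only [this, true_or, or_true]
  · have := base_flex hd hab hf hg ha ha' hb; simp only [this, true_or, or_true]
  · have := base_flex hd hab hg hf ha' ha hb; simp only [this, true_or, or_true]
  · have := base_flex hd hab.symm hf hg hb hb' ha; simp only [this, true_or, or_true]
  · have := flexAA hd hab hf hg ha hb; rcases this with h | h | h <;> simp only [h, true_or, or_true]
  · have := flexAB hd hab hf hg ha hb; rcases this with h | h | h <;> simp only [h, true_or, or_true]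
  · have := base_flex hd hab.symm hg hf hb' hb ha; simp only [this, true_or, or_true]
  · have := flexAB hd hab hg hf ha hb; rcases this with h | h | h <;> simp only [h, true_or, or_true]
  · have := flexAA hd hab hg hf ha hb; rcases this with h | h | h <;> simp only [h, true_or, or_true]

open Polynomial in
lemma JJ_der2 (f g : ℂ[X]) : derivative (derivative (JJ f g)) = f * derivative (derivative (derivative g)) +
    derivative f * derivative (derivative g) - derivative (derivative f) * derivative g
     - derivative (derivative (derivative f)) * g := by
  rw [JJ_der]; simp; ring

open Polynomial in
lemma base_zz {d : ℕ} (hd : 3 ≤ d) {f g : ℂ[X]} {a : ℂ}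
    (hf : f.degree < (d + 1 : ℕ)) (hg : g.degree < (d + 1 : ℕ))
    (h1 : f.eval a = 0) (h2 : g.eval a = 0) (h3 : (derivative (derivative (JJ f g))).eval a = 0)
    (h4 : (derivative g).eval a ≠ 0) : fam3 d f g := by
  rw [JJ_der2] at h3
  simp [h1, h2] at h3
  obtain ⟨q, hq⟩ := dvd1 g a h2
  obtain ⟨p, hp⟩ := dvd3 (f - C ((derivative f).eval a / (derivative g).eval a) * g) a (by simp [h1, h2])
    (by simp; field_simp; simp) (by simp; field_simp; linear_combination -h3)
  have he : f = C ((derivative f).eval a / (derivative g).eval a) * g + (X - C a) ^ 3 * p := by rw [← hp]; ring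
  exact ⟨a, _, p, q, flex_deg hd hf hg ((monic_X_sub_C a).pow 3) (m := 3) (by simp) (by omega) he,
    deg_quot hg (monic_X_sub_C a) (m := 1) (by simp) hq (by omega), he, hq⟩

open Polynomial in
lemma flex_zz {d : ℕ} (hd : 3 ≤ d) {f g : ℂ[X]} {a : ℂ}
    (hf : f.degree < (d + 1 : ℕ)) (hg : g.degree < (d + 1 : ℕ))
    {c : ℂ} {p : ℂ[X]} (h : f = C c * g + (X - C a) ^ 3 * p)
    (h3 : (derivative (derivative (JJ f g))).eval a = 0)
    (h4 : g.eval a ≠ 0) : fam6 d f g := by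
  have hp : p.eval a = 0 := by
    rw [JJ_der2, h] at h3
    simp [derivative_pow] at h3
    ring_nf at h3
    have : g.eval a * p.eval a = 0 := by linear_combination (-1/6) * h3
    exact (mul_eq_zero.1 this).resolve_left h4
  obtain ⟨r, hr⟩ := dvd1 p a hp
  have he : f = C c * g + (X - C a) ^ 4 * r := by rw [h, hr]; ring
  exact ⟨a, c, r, flex_deg hd hf hg ((monic_X_sub_C a).pow 4) (m := 4) (by simp) (by omega) he, hg, he⟩

open Polynomial in
lemma J_zz_bad {d : ℕ} (hd : 3 ≤ d) {f g f1 g1 : ℂ[X]} {a : ℂ}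
    (hf : f.degree < (d + 1 : ℕ)) (hg : g.degree < (d + 1 : ℕ))
    (h1 : (JJ f g).eval a = 0) (h2 : (derivative (JJ f g)).eval a = 0)
    (h3 : (derivative (derivative (JJ f g))).eval a = 0) :
    BadQ d f g f1 g1 ∨ BadQ d g f g1 f1 := by
  unfold BadQ
  have h3' : (derivative (derivative (JJ g f))).eval a = 0 := by rw [JJ_swap]; simpa using h3
  rcases flex_cases h1 h2 with ⟨ha, ha'⟩ | ⟨h, c, p, ha⟩ | ⟨h, c, p, ha⟩
  · by_cases hg1 : (derivative g).eval a = 0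
    · by_cases hf1 : (derivative f).eval a = 0
      · have := base_double hd hf hg ha ha' hf1 hg1; simp only [this, true_or, or_true]
      · have := base_zz hd hg hf ha' ha h3' hf1; simp only [this, true_or, or_true]
    · have := base_zz hd hf hg ha ha' h3 hg1; simp only [this, true_or, or_true]
  · have := flex_zz hd hf hg ha h3 h; simp only [this, true_or, or_true]
  · have := flex_zz hd hg hf ha h3' h; simp only [this, true_or, or_true]

open Polynomial in
lemma base_tr1 {d : ℕ} (hd : 3 ≤ d) {f g f1 g1 : ℂ[X]} {a : ℂ}
    (hf : f.degree < (d + 1 : ℕ)) (hg : g.degree < (d + 1 : ℕ)) (hf1 : f1.degree < d) (hg1 : g1.degree < d)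
    (h1 : f.eval a = 0) (h2 : g.eval a = 0)
    (h3 : f1.eval a * (derivative g).eval a - g1.eval a * (derivative f).eval a = 0)
    (h4 : (derivative g).eval a ≠ 0) : fam10 d f g f1 g1 := by
  obtain ⟨q, hq⟩ := dvd1 g a h2
  set c := (derivative f).eval a / (derivative g).eval a with hc
  obtain ⟨p, hp⟩ := dvd2 (f - C c * g) a (by simp [h1, h2]) (by simp [hc]; field_simp; simp)
  have he : f = C c * g + (X - C a) ^ 2 * p := by rw [← hp]; ring
  obtain ⟨r, hr⟩ := dvd1 (f1 - C c * g1) a (by simp [hc]; field_simp; linear_combination h3)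
  refine ⟨a, c, p, q, r, flex_deg hd hf hg ((monic_X_sub_C a).pow 2) (m := 2) (by simp) (by omega) he,
    deg_quot hg (monic_X_sub_C a) (m := 1) (by simp) hq (by omega), ?_, hg1, hq, he, by rw [← hr]; ring⟩
  refine deg_quot (n := d) ?_ (monic_X_sub_C a) (m := 1) (by simp) hr (by omega)
  exact lt_of_le_of_lt (degree_sub_le _ _) (max_lt hf1 (C_mul_deg _ hg1))

open Polynomial in
lemma base_tr_bad {d : ℕ} (hd : 3 ≤ d) {f g f1 g1 : ℂ[X]} {a : ℂ}
    (hf : f.degree < (d + 1 : ℕ)) (hg : g.degree < (d + 1 : ℕ)) (hf1 : f1.degree < d) (hg1 : g1.degree < d)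
    (ha : f.eval a = 0) (ha' : g.eval a = 0)
    (h3 : f1.eval a * (derivative g).eval a - g1.eval a * (derivative f).eval a = 0) :
    BadQ d f g f1 g1 ∨ BadQ d g f g1 f1 := by
  unfold BadQ
  by_cases h : (derivative g).eval a = 0
  · by_cases h' : (derivative f).eval a = 0
    · have := base_double hd hf hg ha ha' h' h; simp only [this, true_or, or_true]
    · have := base_tr1 hd hg hf hg1 hf1 ha' ha (by linear_combination -h3) h'; simp only [this, true_or, or_true]
  · have := base_tr1 hd hf hg hf1 hg1 ha ha' h3 h; simp only [this, true_or, or_true]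

open Polynomial in
lemma flex_tr {d : ℕ} (hd : 3 ≤ d) {f g f1 g1 : ℂ[X]} {a : ℂ}
    (hf : f.degree < (d + 1 : ℕ)) (hg : g.degree < (d + 1 : ℕ)) (hf1 : f1.degree < d) (hg1 : g1.degree < d)
    {c : ℂ} {p : ℂ[X]} (h : f = C c * g + (X - C a) ^ 3 * p)
    (h3 : (JJ f1 g).eval a + (JJ f g1).eval a = 0)
    (h4 : g.eval a ≠ 0) : fam9 d f g f1 g1 := by
  have e0 : f.eval a = c * g.eval a := by rw [h]; simp
  have e1 : (derivative f).eval a = c * (derivative g).eval a := by rw [h]; simp [derivative_pow]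
  unfold JJ at h3
  simp [e0, e1] at h3
  set α := (f1.eval a - c * g1.eval a) / g.eval a with hα
  obtain ⟨q, hq⟩ := dvd2 (g - (C (g.eval a) + C ((derivative g).eval a) * (X - C a))) a (by simp) (by simp)
  obtain ⟨r, hr⟩ := dvd2 (f1 - C c * g1 - C α * (C (g.eval a) + C ((derivative g).eval a) * (X - C a))) a
    (by simp [hα]; field_simp; simp) (by simp [hα]; field_simp; linear_combination -h3)
  have hlin : ∀ n : ℕ, 2 ≤ n → (C (g.eval a) + C ((derivative g).eval a) * (X - C a)).degree < (n : WithBot ℕ) := by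
    intro n hn
    refine lt_of_le_of_lt (degree_add_le _ _) (max_lt ?_ (C_mul_deg _ ?_))
    · exact lt_of_le_of_lt degree_C_le (by exact_mod_cast (by omega : 0 < n))
    · rw [degree_X_sub_C]; exact_mod_cast (by omega : 1 < n)
  refine ⟨a, c, α, g.eval a, (derivative g).eval a, p, q, r,
    flex_deg hd hf hg ((monic_X_sub_C a).pow 3) (m := 3) (by simp) (by omega) h, ?_, ?_, hg1,
    by rw [← hq]; ring, h, by rw [← hr]; ring⟩
  · refine deg_quot (n := d + 1) ?_ ((monic_X_sub_C a).pow 2) (m := 2) (by simp) hq (by omega)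
    exact lt_of_le_of_lt (degree_sub_le _ _) (max_lt hg (hlin _ (by omega)))
  · refine deg_quot (n := d) ?_ ((monic_X_sub_C a).pow 2) (m := 2) (by simp) hr (by omega)
    refine lt_of_le_of_lt (degree_sub_le _ _) (max_lt ?_ (C_mul_deg _ (hlin _ (by omega))))
    exact lt_of_le_of_lt (degree_sub_le _ _) (max_lt hf1 (C_mul_deg _ hg1))

open Polynomial in
lemma J_u_bad {d : ℕ} (hd : 3 ≤ d) {f g f1 g1 : ℂ[X]} {a : ℂ}
    (hf : f.degree < (d + 1 : ℕ)) (hg : g.degree < (d + 1 : ℕ)) (hf1 : f1.degree < d) (hg1 : g1.degree < d)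
    (h1 : (JJ f g).eval a = 0) (h2 : (derivative (JJ f g)).eval a = 0)
    (h3 : (JJ f1 g).eval a + (JJ f g1).eval a = 0) :
    BadQ d f g f1 g1 ∨ BadQ d g f g1 f1 := by
  rcases flex_cases h1 h2 with ⟨ha, ha'⟩ | ⟨h, c, p, ha⟩ | ⟨h, c, p, ha⟩
  · apply base_tr_bad hd hf hg hf1 hg1 ha ha'
    unfold JJ at h3
    simp [ha, ha'] at h3
    linear_combination h3
  · have := flex_tr hd hf hg hf1 hg1 ha h3 h; unfold BadQ; simp only [this, true_or, or_true]
  · have := flex_tr hd hg hf hg1 hf1 ha (by rw [JJ_swap f g1, JJ_swap f1 g]; simp; linear_combination -h3) h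
    unfold BadQ; simp only [this, true_or, or_true]

open Polynomial in
lemma deg_lt_of_coeff {h : ℂ[X]} {k : ℕ} (hh : h.degree < (k + 1 : ℕ)) (h0 : h.coeff k = 0) : h.degree < k := by
  rw [degree_lt_iff_coeff_zero] at hh ⊢
  intro m hm
  rcases hm.eq_or_lt with rfl | hm
  · exact h0
  · exact hh m hm

open Polynomial in
lemma J_inf1 {d : ℕ} (hd : 3 ≤ d) {f g : ℂ[X]}
    (hf : f.degree < (d + 1 : ℕ)) (hg : g.degree < (d + 1 : ℕ)) (hg0 : g.coeff d ≠ 0)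
    (h1 : (JJ f g).coeff (2 * d - 2) = 0) (h2 : (JJ f g).coeff (2 * d - 3) = 0) : fam8 d f g := by
  set c := f.coeff d / g.coeff d with hc
  obtain ⟨e, rfl⟩ := Nat.exists_eq_add_of_le hd
  set h := f - C c * g with hh
  have hJ : JJ f g = h * derivative g - derivative h * g := by
    unfold JJ; rw [hh]; simp; ring
  have hnat : ∀ (p : ℂ[X]) (k : ℕ), p.degree < (k + 1 : ℕ) → p.natDegree ≤ k := fun p k h => by
    
    rw [natDegree_le_iff_coeff_eq_zero]
    rw [degree_lt_iff_coeff_zero] at h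
    exact fun m hm => h m hm
  have hgn := hnat _ _ hg
  have d0 : h.degree < (3 + e : ℕ) := deg_lt_of_coeff (lt_of_le_of_lt (degree_sub_le _ _) (max_lt hf (C_mul_deg _ hg)))
    (by simp [hh, hc, hg0])
  have step : ∀ k : ℕ, k + 1 < 3 + e → h.degree < (k + 2 : ℕ) → (JJ f g).coeff (3 + e + k) = 0 → h.degree < (k + 1 : ℕ) := by
    intro k hk hdeg hJ0
    apply deg_lt_of_coeff (by simpa [add_assoc] using hdeg)
    have hn := hnat _ (k + 1) hdeg
    have e1 : (h * derivative g).coeff (3 + e + k) = h.coeff (k + 1) * (derivative g).coeff (2 + e) := by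
      rw [show 3 + e + k = (k + 1) + (2 + e) by ring]
      exact coeff_mul_add_eq_of_natDegree_le hn ((natDegree_derivative_le _).trans (by omega))
    have e2 : (derivative h * g).coeff (3 + e + k) = (derivative h).coeff k * g.coeff (3 + e) := by
      rw [show 3 + e + k = k + (3 + e) by ring]
      exact coeff_mul_add_eq_of_natDegree_le ((natDegree_derivative_le _).trans (by omega)) hgn
    rw [hJ, coeff_sub, e1, e2, coeff_derivative, coeff_derivative, show 2 + e + 1 = 3 + e by ring] at hJ0
    have : h.coeff (k + 1) * (g.coeff (3 + e) * ((3 + e : ℕ) - (k + 1 : ℕ) : ℂ)) = 0 := by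
      push_cast at hJ0 ⊢; linear_combination hJ0
    refine (mul_eq_zero.1 this).resolve_right (mul_ne_zero hg0 ?_)
    rw [sub_ne_zero]; exact_mod_cast hk.ne'
  have s1 := step (1 + e) (by omega) (by convert d0 using 2; omega) (by rw [← h1]; congr 1; omega)
  have s2 := step e (by omega) (by convert s1 using 2; omega) (by rw [← h2]; congr 1; omega)
  exact ⟨c, h, by convert s2 using 2; omega, hg, by rw [hh]; ring⟩

open Polynomial in
lemma inf_bad {d : ℕ} (hd : 3 ≤ d) {f g : ℂ[X]}
    (hf : f.degree < (d + 1 : ℕ)) (hg : g.degree < (d + 1 : ℕ)) (h7 : ¬ fam7 d f g) (h8 : ¬ fam8 d f g) (h8' : ¬ fam8 d g f) :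
    (f.coeff d ≠ 0 ∨ g.coeff d ≠ 0) ∧ ((JJ f g).coeff (2 * d - 2) ≠ 0 ∨ (JJ f g).coeff (2 * d - 3) ≠ 0) := by
  have h0 : f.coeff d ≠ 0 ∨ g.coeff d ≠ 0 := by
    by_contra hcon
    push Not at hcon
    exact h7 ⟨deg_lt_of_coeff hf hcon.1, deg_lt_of_coeff hg hcon.2⟩
  refine ⟨h0, ?_⟩
  by_contra hcon
  push Not at hcon
  rcases h0 with h0 | h0
  · exact h8' (J_inf1 hd hg hf h0 (by rw [JJ_swap]; simpa using hcon.1) (by rw [JJ_swap]; simpa using hcon.2))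
  · exact h8 (J_inf1 hd hf hg h0 hcon.1 hcon.2)

open Polynomial in
lemma goodU_of {d : ℕ} (hd : 3 ≤ d) {f g f1 g1 : ℂ[X]}
    (hf : f.degree < (d + 1 : ℕ)) (hg : g.degree < (d + 1 : ℕ)) (hf1 : f1.degree < d) (hg1 : g1.degree < d)
    (hb : ¬ BadQ d f g f1 g1) (hb' : ¬ BadQ d g f g1 f1) : GoodU d f g f1 g1 := by
  have hinf := inf_bad hd hf hg (by unfold BadQ at hb; tauto) (by unfold BadQ at hb; tauto) (by unfold BadQ at hb'; tauto)
  refine ⟨?_, ?_, hinf.1, ?_, ?_, ?_, hinf.2⟩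
  · intro a b h1 h2 h3 h4
    by_contra hab
    have := base_base hd hab hf hg h1 h2 h3 h4
    unfold BadQ at hb; tauto
  · intro a h1 h2 h3
    rcases base_tr_bad hd hf hg hf1 hg1 h1 h2 h3 with h | h <;> contradiction
  · intro a b h1 h2 h3 h4
    by_contra hab
    rcases J_uniq_bad hd hab hf hg h1 h2 h3 h4 (f1 := f1) (g1 := g1) with h | h <;> contradiction
  · intro a h1 h2 h3
    rcases J_u_bad hd hf hg hf1 hg1 h1 h2 h3 with h | h <;> contradiction
  · intro a h1 h2 h3
    rcases J_zz_bad hd hf hg h1 h2 h3 (f1 := f1) (g1 := g1) with h | h <;> contradiction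

open Polynomial in
lemma goodI_of {d : ℕ} (hd : 3 ≤ d) {f g : ℂ[X]}
    (hf : f.degree < (d + 1 : ℕ)) (hg : g.degree < (d + 1 : ℕ))
    (hb : ¬ BadI d f g) (hb' : ¬ BadI d g f) : GoodI d f g := by
  unfold BadI at hb hb'
  have hinf := inf_bad hd hf hg (by tauto) (by tauto) (by tauto)
  have hbase : ∀ a, f.eval a = 0 → g.eval a = 0 → False := by
    intro a h1 h2
    obtain ⟨p, hp⟩ := dvd1 f a h1
    obtain ⟨q, hq⟩ := dvd1 g a h2
    have : fam11 d f g := ⟨a, p, q, deg_quot hf (monic_X_sub_C a) (m := 1) (by simp) hp (by omega),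
      deg_quot hg (monic_X_sub_C a) (m := 1) (by simp) hq (by omega), hp, hq⟩
    tauto
  refine ⟨hbase, hinf.1, ?_, hinf.2⟩
  intro a h1 h2
  rcases flex_cases h1 h2 with ⟨ha, ha'⟩ | ⟨h, c, p, ha⟩ | ⟨h, c, p, ha⟩
  · exact hbase a ha ha'
  · have : fam12 d f g := ⟨a, c, p, flex_deg hd hf hg ((monic_X_sub_C a).pow 3) (m := 3) (by simp) (by omega) ha, hg, ha⟩
    tauto
  · have : fam12 d g f := ⟨a, c, p, flex_deg hd hg hf ((monic_X_sub_C a).pow 3) (m := 3) (by simp) (by omega) ha, hf, ha⟩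
    tauto


open Polynomial in
lemma count2 {m n N ea eb : ℕ} (A B AI BI : ℂ[X][X]) (hA : A.natDegree ≤ m) (hB : B.natDegree ≤ n)
    (hAI : AI.natDegree ≤ m) (hBI : BI.natDegree ≤ n)
    (hmn : 0 < m + n) (hN : ea * n + eb * m = N + m * n)
    (hsA : ∀ v : ℂ, v ≠ 0 → atU v AI = C (v ^ ea) * (atU v⁻¹ A).comp (C v⁻¹ * X))
    (hsB : ∀ v : ℂ, v ≠ 0 → atU v BI = C (v ^ eb) * (atU v⁻¹ B).comp (C v⁻¹ * X))
    (hI : ∀ z, (atU 0 AI).eval z = 0 → (atU 0 BI).eval z = 0 → False)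
    (hIinf : (atU 0 AI).coeff m ≠ 0 ∨ (atU 0 BI).coeff n ≠ 0)
    (hinf : ∀ u0, (atU u0 A).coeff m ≠ 0 ∨ (atU u0 B).coeff n ≠ 0)
    (huniq : ∀ u0 z z', (atU u0 A).eval z = 0 → (atU u0 B).eval z = 0 →
      (atU u0 A).eval z' = 0 → (atU u0 B).eval z' = 0 → z = z')
    (htr : ∀ u0 z0, (atU u0 A).eval z0 = 0 → (atU u0 B).eval z0 = 0 →
      (atU u0 (dU A)).eval z0 * (derivative (atU u0 B)).eval z0 -
      (atU u0 (dU B)).eval z0 * (derivative (atU u0 A)).eval z0 ≠ 0) :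
    ∃ S : Finset ℂ, S.card = N ∧ ∀ u, u ∈ S ↔ ∃ z, (atU u A).eval z = 0 ∧ (atU u B).eval z = 0 := by
  have hev : ∀ (A B : ℂ[X][X]) (u : ℂ), (resultant A B m n).eval u = resultant (atU u A) (atU u B) m n := by
    intro A B u
    rw [resultant_map_map]; rfl
  obtain ⟨h1, h2⟩ := natDegree_of_infty (resultant A B m n) (resultant AI BI m n) N (by
    intro v hv
    rw [hev, hev, hsA v hv, hsB v hv, resultant_C_mul_left, resultant_C_mul_right,
      res_scale _ _ _ _ _ (inv_ne_zero hv)]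
    rw [← mul_assoc, ← mul_assoc]
    congr 1
    have : v ^ (m * n) * v⁻¹ ^ (m * n) = 1 := by rw [← mul_pow, mul_inv_cancel₀ hv, one_pow]
    rw [← pow_mul, ← pow_mul, ← pow_add, hN, pow_add, mul_assoc, this, mul_one]) (by
    rw [hev, Ne, resultant_zero_iff' (natDegree_map_le.trans hAI) (natDegree_map_le.trans hBI) hmn hIinf]
    rintro ⟨z, hz, hz'⟩
    exact hI z hz hz')
  exact count_common A B hA hB hmn h2 h1 hinf huniq htr

open Polynomial in
lemma dU_add (a b : ℂ[X][X]) : dU (a + b) = dU a + dU b := by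
  ext1 k; simp [dU_coeff]

open Polynomial in
lemma dU_sub (a b : ℂ[X][X]) : dU (a - b) = dU a - dU b := by
  ext1 k; simp [dU_coeff]

open Polynomial in
lemma dU_mul (a b : ℂ[X][X]) : dU (a * b) = dU a * b + a * dU b := by
  ext1 k
  simp only [dU_coeff, coeff_add, coeff_mul, derivative_sum, derivative_mul, Finset.sum_add_distrib]

open Polynomial in
lemma dU_derivative (a : ℂ[X][X]) : dU (derivative a) = derivative (dU a) := by
  ext1 k
  simp only [dU_coeff, coeff_derivative, derivative_mul]
  simp

open Polynomial in
lemma dU_X : dU (X : ℂ[X][X]) = 0 := by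
  ext1 k
  simp only [dU_coeff, coeff_X]; split_ifs <;> simp

open Polynomial in
lemma dU_nat (n : ℕ) : dU (n : ℂ[X][X]) = 0 := by
  ext1 k
  simp only [dU_coeff]
  rw [← C_eq_natCast, coeff_C]; split_ifs <;> simp

open Polynomial in
lemma natDegree_JJ {R : Type*} [CommRing R] {f g : R[X]} {d : ℕ} (hd : 1 ≤ d) (hf : f.natDegree ≤ d) (hg : g.natDegree ≤ d) :
    (JJ f g).natDegree ≤ 2 * d - 2 := by
  obtain ⟨e, rfl⟩ := Nat.exists_eq_add_of_le hd
  have hf' : (derivative f).natDegree ≤ e := (natDegree_derivative_le _).trans (by omega)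
  have hg' : (derivative g).natDegree ≤ e := (natDegree_derivative_le _).trans (by omega)
  rw [natDegree_le_iff_coeff_eq_zero]
  intro k hk
  rcases (show 2 * e + 1 ≤ k by omega).eq_or_lt with rfl | hlt
  · unfold JJ
    rw [coeff_sub]
    have e1 : (f * derivative g).coeff (2 * e + 1) = f.coeff (1 + e) * (derivative g).coeff e := by
      rw [show 2 * e + 1 = (1 + e) + e by ring]; exact coeff_mul_add_eq_of_natDegree_le hf hg'
    have e2 : (derivative f * g).coeff (2 * e + 1) = (derivative f).coeff e * g.coeff (1 + e) := by
      rw [show 2 * e + 1 = e + (1 + e) by ring]; exact coeff_mul_add_eq_of_natDegree_le hf' hg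
    rw [e1, e2, coeff_derivative, coeff_derivative, add_comm 1 e]; ring
  · apply coeff_eq_zero_of_natDegree_lt
    refine lt_of_le_of_lt (natDegree_sub_le _ _) (max_lt ?_ ?_) <;>
    exact lt_of_le_of_lt natDegree_mul_le (by omega)

open Polynomial in
noncomputable def AAJ {R : Type*} [CommRing R] (n : ℕ) (J : R[X]) : R[X] := (n : R[X]) * J - X * derivative J

open Polynomial in
lemma AAJ_coeff {R : Type*} [CommRing R] (n : ℕ) (J : R[X]) (k : ℕ) :
    (AAJ n J).coeff k = ((n : R) - k) * J.coeff k := by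
  unfold AAJ
  rw [coeff_sub, coeff_natCast_mul]
  cases k with
  | zero => simp
  | succ k => rw [coeff_X_mul, coeff_derivative]; push_cast; ring

open Polynomial in
lemma natDegree_AAJ {R : Type*} [CommRing R] {n : ℕ} {J : R[X]} (h : J.natDegree ≤ n + 1) :
    (AAJ (n + 1) J).natDegree ≤ n := by
  rw [natDegree_le_iff_coeff_eq_zero]
  intro k hk
  rw [AAJ_coeff]
  rcases (show n + 1 ≤ k from hk).eq_or_lt with rfl | hlt
  · simp
  · rw [coeff_eq_zero_of_natDegree_lt (lt_of_le_of_lt h hlt), mul_zero]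

open Polynomial in
lemma atU_JJ (u : ℂ) (f g : ℂ[X][X]) : atU u (JJ f g) = JJ (atU u f) (atU u g) := by
  unfold JJ; simp [derivative_map]

open Polynomial in
lemma atU_AAJ (u : ℂ) (n : ℕ) (f : ℂ[X][X]) : atU u (AAJ n f) = AAJ n (atU u f) := by
  unfold AAJ; simp [derivative_map]

open Polynomial in
lemma atU_der (u : ℂ) (f : ℂ[X][X]) : atU u (derivative f) = derivative (atU u f) := (derivative_map _ _).symm

open Polynomial in
lemma der_scale (f : ℂ[X]) (a c : ℂ) : derivative (C a * f.comp (C c * X)) = C (a * c) * (derivative f).comp (C c * X) := by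
  simp [derivative_comp]; ring

open Polynomial in
lemma dvd_flex_JJ {f g p : ℂ[X]} {z l μ : ℂ} (h : C l * f + C μ * g = (X - C z) ^ 3 * p) (hl : l ≠ 0 ∨ μ ≠ 0) :
    (JJ f g).eval z = 0 ∧ (derivative (JJ f g)).eval z = 0 := by
  have h0 := congrArg (eval z) h
  have h1 := congrArg (fun q => eval z (derivative q)) h
  have h2 := congrArg (fun q => eval z (derivative (derivative q))) h
  simp [derivative_pow] at h0 h1 h2
  rw [JJ_der]; unfold JJ; simp
  rcases hl with hl | hl
  · constructor <;> apply mul_left_cancel₀ hl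
    · linear_combination (derivative g).eval z * h0 - g.eval z * h1
    · linear_combination (derivative (derivative g)).eval z * h0 - g.eval z * h2
  · constructor <;> apply mul_left_cancel₀ hl
    · linear_combination -(derivative f).eval z * h0 + f.eval z * h1
    · linear_combination -(derivative (derivative f)).eval z * h0 + f.eval z * h2

open Polynomial in
lemma not_base_flex {f g p : ℂ[X]} {z l μ : ℂ} (h : C l * f + C μ * g = (X - C z) ^ 3 * p) (hl : l ≠ 0 ∨ μ ≠ 0)
    (hf : f.eval z = 0) (hg : g.eval z = 0) : (derivative (derivative (JJ f g))).eval z = 0 := by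
  have h1 := congrArg (fun q => eval z (derivative q)) h
  have h2 := congrArg (fun q => eval z (derivative (derivative q))) h
  simp [derivative_pow] at h1 h2
  rw [JJ_der2]; simp [hf, hg]
  rcases hl with hl | hl
  · apply mul_left_cancel₀ hl
    linear_combination (derivative (derivative g)).eval z * h1 - (derivative g).eval z * h2
  · apply mul_left_cancel₀ hl
    linear_combination -(derivative (derivative f)).eval z * h1 + (derivative f).eval z * h2

open Polynomial in
theorem count_flex {d : ℕ} (hd : 3 ≤ d) (Φ Ψ ΦI ΨI : ℂ[X][X])
    (h1 : Φ.natDegree ≤ d) (h2 : Ψ.natDegree ≤ d) (h3 : ΦI.natDegree ≤ d) (h4 : ΨI.natDegree ≤ d)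
    (hsA : ∀ v : ℂ, v ≠ 0 → atU v ΦI = C (v ^ d) * (atU v⁻¹ Φ).comp (C v⁻¹ * X))
    (hsB : ∀ v : ℂ, v ≠ 0 → atU v ΨI = C (v ^ d) * (atU v⁻¹ Ψ).comp (C v⁻¹ * X))
    (hgood : ∀ u, GoodU d (atU u Φ) (atU u Ψ) (atU u (dU Φ)) (atU u (dU Ψ)))
    (hI : GoodI d (atU 0 ΦI) (atU 0 ΨI)) :
    ∃ S : Finset ℂ, S.card + d ^ 2 = (2 * d - 3) * (2 * d) ∧
      ∀ u, u ∈ S ↔ ∃ z l μ : ℂ, (l ≠ 0 ∨ μ ≠ 0) ∧ (X - C z) ^ 3 ∣ C l * atU u Φ + C μ * atU u Ψ := by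
  classical
  obtain ⟨e, rfl⟩ := Nat.exists_eq_add_of_le hd
  obtain ⟨S0, hS0, hS0'⟩ := count2 (m := 3 + e) (n := 3 + e) (N := (3 + e) ^ 2) Φ Ψ ΦI ΨI h1 h2 h3 h4 (by omega) (by ring) hsA hsB
    hI.base hI.base_inf (fun u => (hgood u).base_inf)
    (fun u z z' a b c d => (hgood u).base_uniq z z' a b c d) (fun u z a b => (hgood u).base_tr z a b)
  have hJJn : (JJ Φ Ψ).natDegree ≤ (2 * e + 3) + 1 := (natDegree_JJ (by omega) h1 h2).trans (by omega)
  have hJJIn : (JJ ΦI ΨI).natDegree ≤ (2 * e + 3) + 1 := (natDegree_JJ (by omega) h3 h4).trans (by omega)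
  have hAJ : ∀ (J : ℂ[X]) (z : ℂ), ((AAJ (2 * e + 3 + 1) J).eval z = 0 ∧ (derivative J).eval z = 0) ↔ (J.eval z = 0 ∧ (derivative J).eval z = 0) := by
    intro J z
    unfold AAJ
    constructor
    · rintro ⟨a, b⟩
      simp [b] at a
      refine ⟨a.resolve_left ?_, b⟩
      exact_mod_cast (by omega : 2 * e + 3 + 1 ≠ 0)
    · rintro ⟨a, b⟩
      simp [a, b]
  have hJinf : ∀ J : ℂ[X], J.coeff (2 * (3 + e) - 2) ≠ 0 ∨ J.coeff (2 * (3 + e) - 3) ≠ 0 →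
     (AAJ (2 * e + 3 + 1) J).coeff (2 * e + 3) ≠ 0 ∨ (derivative J).coeff (2 * e + 3) ≠ 0 := by
    intro J h
    rw [AAJ_coeff, coeff_derivative]
    rcases h with h | h
    · right
      rw [show 2 * (3 + e) - 2 = 2 * e + 3 + 1 by omega] at h
      exact mul_ne_zero h (by exact_mod_cast (by omega : 2 * e + 3 + 1 ≠ 0))
    · left
      rw [show 2 * (3 + e) - 3 = 2 * e + 3 by omega] at h
      exact mul_ne_zero (by push_cast; ring_nf; norm_num) h
  have hJs : ∀ v : ℂ, v ≠ 0 → JJ (atU v ΦI) (atU v ΨI) = C (v ^ (2 * e + 5)) * (JJ (atU v⁻¹ Φ) (atU v⁻¹ Ψ)).comp (C v⁻¹ * X) := by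
    intro v hv
    rw [hsA v hv, hsB v hv]
    have hh : C (v ^ (3 + e) * v⁻¹) = C (v ^ (2 + e)) := by congr 1; rw [show 3 + e = 2 + e + 1 by ring, pow_succ]; field_simp
    unfold JJ
    rw [der_scale, der_scale, hh, show 2 * e + 5 = (3 + e) + (2 + e) by ring, pow_add, C_mul]
    simp
    ring
  have hJs' : ∀ v : ℂ, v ≠ 0 → derivative (JJ (atU v ΦI) (atU v ΨI)) = C (v ^ (2 * e + 4)) * (derivative (JJ (atU v⁻¹ Φ) (atU v⁻¹ Ψ))).comp (C v⁻¹ * X) := by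
    intro v hv
    rw [hJs v hv, der_scale]
    congr 2
    rw [pow_succ]; field_simp
  obtain ⟨S, hS, hS'⟩ := count2 (m := 2 * e + 3) (n := 2 * e + 3) (N := (2 * e + 3) * (2 * e + 6)) (ea := 2 * e + 5) (eb := 2 * e + 4)
    (AAJ (2 * e + 3 + 1) (JJ Φ Ψ)) (derivative (JJ Φ Ψ))
    (AAJ (2 * e + 3 + 1) (JJ ΦI ΨI)) (derivative (JJ ΦI ΨI))
    (natDegree_AAJ hJJn) ((natDegree_derivative_le _).trans (by omega))
    (natDegree_AAJ hJJIn) ((natDegree_derivative_le _).trans (by omega)) (by omega) (by ring)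
    (by
      intro v hv
      have hX : C (v ^ (2 * e + 5)) * (C v⁻¹ * X) = C (v ^ (2 * e + 4)) * (X : ℂ[X]) := by
        rw [← mul_assoc, ← C_mul]
        congr 2
        rw [pow_succ]; field_simp
      rw [atU_AAJ, atU_AAJ, atU_JJ, atU_JJ]
      unfold AAJ
      rw [hJs' v hv, hJs v hv]
      simp only [sub_comp, mul_comp, X_comp, natCast_comp]
      linear_combination ((derivative (JJ (atU v⁻¹ Φ) (atU v⁻¹ Ψ))).comp (C v⁻¹ * X)) * hX)
    (by
      intro v hv
      rw [atU_der, atU_der, atU_JJ, atU_JJ]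
      exact hJs' v hv)
    (by
      intro z a b
      rw [atU_der, atU_JJ] at b
      rw [atU_AAJ, atU_JJ] at a
      have := (hAJ _ z).1 ⟨a, b⟩
      exact hI.J z this.1 this.2)
    (by
      rw [atU_der, atU_AAJ, atU_JJ]
      exact hJinf _ hI.J_inf)
    (by
      intro u
      rw [atU_der, atU_AAJ, atU_JJ]
      exact hJinf _ (hgood u).J_inf)
    (by
      intro u z z' a b a' b'
      rw [atU_der, atU_JJ] at b b'
      rw [atU_AAJ, atU_JJ] at a a'
      have := (hAJ _ z).1 ⟨a, b⟩
      have t := (hAJ _ z').1 ⟨a', b'⟩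
      exact (hgood u).J_uniq z z' this.1 this.2 t.1 t.2)
    (by
      intro u z a b
      rw [atU_der, atU_JJ] at b
      rw [atU_AAJ, atU_JJ] at a
      have := (hAJ _ z).1 ⟨a, b⟩
      have hu := (hgood u).J_u z this.1 this.2
      have hz := (hgood u).J_zz z this.1 this.2
      have e1 : atU u (dU (JJ Φ Ψ)) = JJ (atU u (dU Φ)) (atU u Ψ) + JJ (atU u Φ) (atU u (dU Ψ)) := by
        rw [← atU_JJ, ← atU_JJ]
        rw [← Polynomial.map_add]
        congr 1
        unfold JJ
        rw [dU_sub, dU_mul, dU_mul, dU_derivative, dU_derivative]; ring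
      have e2 : dU (AAJ (2 * e + 3 + 1) (JJ Φ Ψ)) = AAJ (2 * e + 3 + 1) (dU (JJ Φ Ψ)) := by
        unfold AAJ
        rw [dU_sub, dU_mul, dU_mul, dU_nat, dU_X, dU_derivative]; ring
      rw [e2, atU_AAJ, dU_derivative, atU_der u (dU _), e1, atU_der, atU_AAJ, atU_JJ]
      unfold AAJ
      have hn : ((2 * e + 3 + 1 : ℕ) : ℂ) ≠ 0 := by exact_mod_cast (by omega : 2 * e + 3 + 1 ≠ 0)
      convert mul_ne_zero (mul_ne_zero hn hu) hz using 1
      simp [b]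
      ring)
  have hS'' : ∀ u, u ∈ S ↔ ∃ z, (JJ (atU u Φ) (atU u Ψ)).eval z = 0 ∧ (derivative (JJ (atU u Φ) (atU u Ψ))).eval z = 0 := by
    intro u
    rw [hS']
    apply exists_congr
    intro z
    rw [atU_der, atU_AAJ, atU_JJ, hAJ]
  have hbJ : ∀ u z, (atU u Φ).eval z = 0 → (atU u Ψ).eval z = 0 →
    (JJ (atU u Φ) (atU u Ψ)).eval z = 0 ∧ (derivative (JJ (atU u Φ) (atU u Ψ))).eval z = 0 := by
    intro u z a b
    rw [JJ_der]; unfold JJ; simp only [eval_sub, eval_mul, a, b]; simp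
  have hsub : S0 ⊆ S := by
    intro u hu
    obtain ⟨z, a, b⟩ := (hS0' u).1 hu
    exact (hS'' u).2 ⟨z, hbJ u z a b⟩
  refine ⟨S \ S0, ?_, ?_⟩
  · rw [← hS0, Finset.card_sdiff_add_card_eq_card hsub, hS, show 2 * (3 + e) - 3 = 2 * e + 3 by omega]; ring
  · intro u
    rw [Finset.mem_sdiff]
    constructor
    · rintro ⟨hu, hu'⟩
      obtain ⟨z, a, b⟩ := (hS'' u).1 hu
      rcases flex_cases a b with h | ⟨-, c, p, h⟩ | ⟨-, c, p, h⟩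
      · exact absurd ((hS0' u).2 ⟨z, h⟩) hu'
      · exact ⟨z, 1, -c, by simp, p, by rw [h]; simp⟩
      · exact ⟨z, -c, 1, by simp, p, by rw [h]; simp⟩
    · rintro ⟨z, l, μ, hl, p, hp⟩
      have hz := dvd_flex_JJ hp hl
      refine ⟨(hS'' u).2 ⟨z, hz⟩, fun h0 => ?_⟩
      obtain ⟨z', a, b⟩ := (hS0' u).1 h0
      have hz' := hbJ u z' a b
      have := (hgood u).J_uniq z z' hz.1 hz.2 hz'.1 hz'.2
      subst this
      exact (hgood u).J_zz z hz.1 hz.2 (not_base_flex hp hl a b)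


/-- polynomial functions -/
def PF {τ : Type} (φ : (τ → ℂ) → ℂ) : Prop := ∃ P : MvPolynomial τ ℂ, ∀ y, φ y = MvPolynomial.eval y P

lemma PF.const {τ : Type} (c : ℂ) : PF (fun _ : τ → ℂ => c) := ⟨MvPolynomial.C c, fun y => by simp⟩
lemma PF.proj {τ : Type} (i : τ) : PF (fun y : τ → ℂ => y i) := ⟨MvPolynomial.X i, fun y => by simp⟩
lemma PF.add {τ : Type} {φ ψ : (τ → ℂ) → ℂ} (h : PF φ) (h' : PF ψ) : PF (fun y => φ y + ψ y) := by
  obtain ⟨P, hP⟩ := h; obtain ⟨Q, hQ⟩ := h'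
  exact ⟨P + Q, fun y => by simp [hP, hQ]⟩
lemma PF.mul {τ : Type} {φ ψ : (τ → ℂ) → ℂ} (h : PF φ) (h' : PF ψ) : PF (fun y => φ y * ψ y) := by
  obtain ⟨P, hP⟩ := h; obtain ⟨Q, hQ⟩ := h'
  exact ⟨P * Q, fun y => by simp [hP, hQ]⟩
lemma PF.neg {τ : Type} {φ : (τ → ℂ) → ℂ} (h : PF φ) : PF (fun y => - φ y) := by
  obtain ⟨P, hP⟩ := h
  exact ⟨-P, fun y => by simp [hP]⟩
lemma PF.sum {ι : Type*} {τ : Type} {φ : ι → (τ → ℂ) → ℂ} (s : Finset ι) (h : ∀ i ∈ s, PF (φ i)) :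
    PF (fun y => ∑ i ∈ s, φ i y) := by
  classical
  induction s using Finset.induction_on with
  | empty => simpa using PF.const 0
  | insert a s ha ih =>
    simp only [Finset.sum_insert ha]
    exact (h a (by simp)).add (ih fun i hi => h i (by simp [hi]))
lemma PF.comp {σ τ : Type} {φ : (σ → ℂ) → ℂ} (h : PF φ) (e : σ → τ) : PF (fun y : τ → ℂ => φ (y ∘ e)) := by
  obtain ⟨P, hP⟩ := h
  exact ⟨MvPolynomial.rename e P, fun y => by show φ (y ∘ e) = _; rw [hP, MvPolynomial.eval_rename]⟩

open Polynomial in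
def PF1 {τ : Type} (φ : (τ → ℂ) → ℂ[X]) : Prop := ∀ k, PF (fun y => (φ y).coeff k)

open Polynomial in
lemma PF1.add {τ : Type} {φ ψ : (τ → ℂ) → ℂ[X]} (h : PF1 φ) (h' : PF1 ψ) : PF1 (fun y => φ y + ψ y) := by
  intro k; simp only [coeff_add]; exact (h k).add (h' k)
open Polynomial in
lemma PF1.sub {τ : Type} {φ ψ : (τ → ℂ) → ℂ[X]} (h : PF1 φ) (h' : PF1 ψ) : PF1 (fun y => φ y - ψ y) := by
  intro k; simp only [coeff_sub]; simp only [sub_eq_add_neg]; exact (h k).add (h' k).neg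
open Polynomial in
lemma PF1.mul {τ : Type} {φ ψ : (τ → ℂ) → ℂ[X]} (h : PF1 φ) (h' : PF1 ψ) : PF1 (fun y => φ y * ψ y) := by
  intro k; simp only [coeff_mul]; exact PF.sum _ fun i _ => (h i.1).mul (h' i.2)
open Polynomial in
lemma PF1.const {τ : Type} (p : ℂ[X]) : PF1 (fun _ : τ → ℂ => p) := fun k => PF.const _
open Polynomial in
lemma PF1.C {τ : Type} {φ : (τ → ℂ) → ℂ} (h : PF φ) : PF1 (fun y => C (φ y)) := by
  intro k; simp only [coeff_C]; split_ifs
  · exact h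
  · exact PF.const 0
open Polynomial in
lemma PF1.pow {τ : Type} {φ : (τ → ℂ) → ℂ[X]} (h : PF1 φ) (n : ℕ) : PF1 (fun y => φ y ^ n) := by
  induction n with
  | zero => simpa using PF1.const 1
  | succ n ih => simp only [pow_succ]; exact ih.mul h
open Polynomial in
lemma PF1.comp {σ τ : Type} {φ : (σ → ℂ) → ℂ[X]} (h : PF1 φ) (e : σ → τ) : PF1 (fun y : τ → ℂ => φ (y ∘ e)) :=
  fun k => (h k).comp e

open Polynomial in
noncomputable def polyOf (k : ℕ) (y : Fin k → ℂ) : ℂ[X] := ∑ i : Fin k, C (y i) * X ^ (i : ℕ)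

open Polynomial in
lemma polyOf_coeff (k : ℕ) (y : Fin k → ℂ) (j : ℕ) : (polyOf k y).coeff j = if h : j < k then y ⟨j, h⟩ else 0 := by
  unfold polyOf
  simp only [finsetSum_coeff, coeff_C_mul, coeff_X_pow]
  split_ifs with h
  · rw [Finset.sum_eq_single ⟨j, h⟩]
    · simp
    · intro b _ hb
      rw [if_neg, mul_zero]
      rintro rfl; exact hb rfl
    · simp
  · apply Finset.sum_eq_zero
    intro b _
    rw [if_neg, mul_zero]
    have := b.2; omega

open Polynomial in
lemma polyOf_surj {k : ℕ} {p : ℂ[X]} (h : p.degree < k) : polyOf k (fun i => p.coeff i) = p := by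
  ext j
  rw [polyOf_coeff]
  split_ifs with hj
  · rfl
  · exact ((degree_lt_iff_coeff_zero _ _).1 h j (by omega)).symm

open Polynomial in
lemma PF1.polyOf {τ : Type} {k : ℕ} (e : Fin k → τ) : PF1 (fun y : τ → ℂ => polyOf k (fun i => y (e i))) := by
  intro j
  simp only [polyOf_coeff]
  split_ifs
  · exact PF.proj _
  · exact PF.const 0

def PF3 {τ : Type} (φ : (τ → ℂ) → MvPolynomial (Fin 3) ℂ) : Prop := ∀ m, PF (fun y => (φ y).coeff m)

lemma PF3.add {τ : Type} {φ ψ : (τ → ℂ) → MvPolynomial (Fin 3) ℂ} (h : PF3 φ) (h' : PF3 ψ) : PF3 (fun y => φ y + ψ y) := by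
  intro k; simp only [MvPolynomial.coeff_add]; exact (h k).add (h' k)
lemma PF3.sub {τ : Type} {φ ψ : (τ → ℂ) → MvPolynomial (Fin 3) ℂ} (h : PF3 φ) (h' : PF3 ψ) : PF3 (fun y => φ y - ψ y) := by
  intro k; simp only [MvPolynomial.coeff_sub]; simp only [sub_eq_add_neg]; exact (h k).add (h' k).neg
lemma PF3.mul {τ : Type} {φ ψ : (τ → ℂ) → MvPolynomial (Fin 3) ℂ} (h : PF3 φ) (h' : PF3 ψ) : PF3 (fun y => φ y * ψ y) := by
  classical
  intro k; simp only [MvPolynomial.coeff_mul]; exact PF.sum _ fun i _ => (h i.1).mul (h' i.2)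
lemma PF3.const {τ : Type} (p : MvPolynomial (Fin 3) ℂ) : PF3 (fun _ : τ → ℂ => p) := fun k => PF.const _
lemma PF3.C {τ : Type} {φ : (τ → ℂ) → ℂ} (h : PF φ) : PF3 (fun y => MvPolynomial.C (φ y)) := by
  classical
  intro k; simp only [MvPolynomial.coeff_C]; split_ifs
  · exact h
  · exact PF.const 0
lemma PF3.pow {τ : Type} {φ : (τ → ℂ) → MvPolynomial (Fin 3) ℂ} (h : PF3 φ) (n : ℕ) : PF3 (fun y => φ y ^ n) := by
  induction n with
  | zero => simpa using PF3.const 1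
  | succ n ih => simp only [pow_succ]; exact ih.mul h
lemma PF3.sum {ι : Type*} {τ : Type} {φ : ι → (τ → ℂ) → MvPolynomial (Fin 3) ℂ} (s : Finset ι) (h : ∀ i ∈ s, PF3 (φ i)) :
    PF3 (fun y => ∑ i ∈ s, φ i y) := by
  intro m
  simp only [MvPolynomial.coeff_sum]
  exact PF.sum _ fun i hi => h i hi m
lemma PF3.rename {τ : Type} {φ : (τ → ℂ) → MvPolynomial (Fin 3) ℂ} (h : PF3 φ) (π : Equiv.Perm (Fin 3)) :
    PF3 (fun y => MvPolynomial.rename π (φ y)) := by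
  intro m
  have : m = Finsupp.mapDomain π (Finsupp.mapDomain π.symm m) := by
    rw [← Finsupp.mapDomain_comp]; simp
  rw [this]
  simp only [MvPolynomial.coeff_rename_mapDomain _ π.injective]
  exact h _

/-- exponents of degree d -/
def Idx (d : ℕ) : Finset (Fin 3 →₀ ℕ) := Finset.finsuppAntidiag Finset.univ d

lemma mem_Idx {d : ℕ} {m : Fin 3 →₀ ℕ} : m ∈ Idx d ↔ m 0 + m 1 + m 2 = d := by
  simp [Idx, Finset.mem_finsuppAntidiag, Fin.sum_univ_three]

lemma hom_mem_Idx {d : ℕ} {F : MvPolynomial (Fin 3) ℂ} (h : F.IsHomogeneous d) {m} (hm : F.coeff m ≠ 0) : m ∈ Idx d := by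
  have := h hm
  rw [mem_Idx, ← this]
  simp [Finsupp.weight_apply, Finsupp.sum_fintype, Fin.sum_univ_three]

/-- algebraic dependence: more coordinates than parameters -/
lemma exists_relation {τ ι : Type} [Fintype τ] [Fintype ι] (h : Fintype.card τ < Fintype.card ι)
    (φ : ι → (τ → ℂ) → ℂ) (hφ : ∀ i, PF (φ i)) :
    ∃ Q : MvPolynomial ι ℂ, Q ≠ 0 ∧ ∀ y, MvPolynomial.eval (fun i => φ i y) Q = 0 := by
  choose P hP using hφ
  have hdep : ¬ AlgebraicIndependent ℂ P := by
    intro hind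
    have := hind.cardinalMk_le_trdeg
    rw [MvPolynomial.trdeg_of_isDomain] at this
    simp at this
    omega
  rw [algebraicIndependent_iff] at hdep
  push Not at hdep
  obtain ⟨Q, h0, h1⟩ := hdep
  refine ⟨Q, h1, fun y => ?_⟩
  have := congrArg (MvPolynomial.eval y) h0
  rw [map_zero] at this
  rw [← this, MvPolynomial.aeval_def, MvPolynomial.algebraMap_eq]
  have h2 : (fun i => φ i y) = fun i => MvPolynomial.eval y (P i) := by ext i; exact hP i y
  rw [h2, ← MvPolynomial.eval₂_id, ← MvPolynomial.coe_eval₂Hom, ← MvPolynomial.coe_eval₂Hom (f := MvPolynomial.C), ← RingHom.comp_apply]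
  congr 1
  ext <;> simp


open Polynomial in
noncomputable def FH (F : MvPolynomial (Fin 3) ℂ) (ξ0 ξ1 : ℂ) : ℂ[X][X] :=
  MvPolynomial.aeval ![1 + C (C ξ0) * X, C X + C (C ξ1) * X, X] F

noncomputable def bld (d : ℕ) (c : (Fin 3 →₀ ℕ) → ℂ) (ξ0 ξ1 u : ℂ) : MvPolynomial (Fin 3) ℂ :=
  ∑ m ∈ Idx d, MvPolynomial.C (c m) * (MvPolynomial.X 0 - MvPolynomial.C ξ0 * MvPolynomial.X 2) ^ (m 0) *
    (MvPolynomial.X 1 - MvPolynomial.C ξ1 * MvPolynomial.X 2 -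
      MvPolynomial.C u * (MvPolynomial.X 0 - MvPolynomial.C ξ0 * MvPolynomial.X 2)) ^ (m 1) *
    (MvPolynomial.X 2) ^ (m 2)

lemma hom_sum {d : ℕ} {F : MvPolynomial (Fin 3) ℂ} (h : F.IsHomogeneous d) :
    F = ∑ m ∈ Idx d, MvPolynomial.C (F.coeff m) * MvPolynomial.X 0 ^ (m 0) * MvPolynomial.X 1 ^ (m 1) *
      MvPolynomial.X 2 ^ (m 2) := by
  conv_lhs => rw [F.as_sum]
  rw [Finset.sum_subset (s₂ := Idx d)]
  · apply Finset.sum_congr rfl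
    intro m _
    rw [MvPolynomial.monomial_eq, Finsupp.prod_fintype _ _ (by simp), Fin.prod_univ_three]
    ring
  · intro m hm
    exact hom_mem_Idx h (MvPolynomial.mem_support_iff.1 hm)
  · intro m _ hm
    rw [MvPolynomial.notMem_support_iff.1 hm]; simp

lemma hom_lin {d : ℕ} {F : MvPolynomial (Fin 3) ℂ} (h : F.IsHomogeneous d) (ξ0 ξ1 u : ℂ) :
    (MvPolynomial.aeval (R := ℂ)
    (![MvPolynomial.X 0 + MvPolynomial.C ξ0 * MvPolynomial.X 2,
      MvPolynomial.X 1 + MvPolynomial.C u * MvPolynomial.X 0 + MvPolynomial.C ξ1 * MvPolynomial.X 2,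
      MvPolynomial.X 2] : Fin 3 → MvPolynomial (Fin 3) ℂ) F).IsHomogeneous d := by
  have h1 : ∀ (a : ℂ) (j : Fin 3), (MvPolynomial.C a * MvPolynomial.X j : MvPolynomial (Fin 3) ℂ).IsHomogeneous 1 := by
    intro a j
    simpa using (MvPolynomial.isHomogeneous_C (Fin 3) a).mul (MvPolynomial.isHomogeneous_X ℂ j)
  have h0 := fun j : Fin 3 => MvPolynomial.isHomogeneous_X ℂ j
  rw [← one_mul d]
  apply h.aeval (n := 1)
  intro i
  fin_cases i
  · exact (h0 0).add (h1 ξ0 2)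
  · exact ((h0 1).add (h1 u 0)).add (h1 ξ1 2)
  · exact h0 2

open Polynomial in
lemma expand {d : ℕ} {F : MvPolynomial (Fin 3) ℂ} (h : F.IsHomogeneous d) (ξ0 ξ1 u : ℂ) :
    ∃ c : (Fin 3 →₀ ℕ) → ℂ, F = bld d c ξ0 ξ1 u ∧
      FH F ξ0 ξ1 = ∑ m ∈ Idx d, C (C (c m) * (X - C u) ^ (m 1)) * X ^ (m 2) := by
  let ψ : MvPolynomial (Fin 3) ℂ →ₐ[ℂ] MvPolynomial (Fin 3) ℂ := MvPolynomial.aeval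
    ![MvPolynomial.X 0 + MvPolynomial.C ξ0 * MvPolynomial.X 2,
      MvPolynomial.X 1 + MvPolynomial.C u * MvPolynomial.X 0 + MvPolynomial.C ξ1 * MvPolynomial.X 2, MvPolynomial.X 2]
  let φ : MvPolynomial (Fin 3) ℂ →ₐ[ℂ] MvPolynomial (Fin 3) ℂ := MvPolynomial.aeval
    ![MvPolynomial.X 0 - MvPolynomial.C ξ0 * MvPolynomial.X 2,
      MvPolynomial.X 1 - MvPolynomial.C ξ1 * MvPolynomial.X 2 -
      MvPolynomial.C u * (MvPolynomial.X 0 - MvPolynomial.C ξ0 * MvPolynomial.X 2), MvPolynomial.X 2]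
  have hC : ∀ (χ : MvPolynomial (Fin 3) ℂ →ₐ[ℂ] MvPolynomial (Fin 3) ℂ) (a : ℂ), χ (MvPolynomial.C a) = MvPolynomial.C a :=
    fun χ a => χ.commutes a
  have hφψ : φ (ψ F) = F := by
    have : φ.comp ψ = AlgHom.id ℂ _ := by
      ext i : 1
      fin_cases i
      · simp only [ψ, AlgHom.comp_apply, MvPolynomial.aeval_X]
        simp [hC, φ]
      · simp only [ψ, AlgHom.comp_apply, MvPolynomial.aeval_X]
        simp [hC, φ]
      · simp [φ, ψ]
    exact congrArg (fun χ => χ F) this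
  have hhom : (ψ F).IsHomogeneous d := hom_lin h ξ0 ξ1 u
  refine ⟨fun m => (ψ F).coeff m, ?_, ?_⟩
  · conv_lhs => rw [← hφψ, hom_sum hhom]
    rw [map_sum]
    apply Finset.sum_congr rfl
    intro m _
    simp [hC, φ]
  · conv_lhs => rw [← hφψ, hom_sum hhom]
    unfold FH
    rw [map_sum, map_sum]
    apply Finset.sum_congr rfl
    intro m _
    simp only [map_mul, map_pow, hC]
    have hC' : ∀ a : ℂ, (algebraMap ℂ ℂ[X][X]) a = C (C a) := fun a => rfl
    simp [φ, hC']

open Polynomial in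
lemma expand_c {d : ℕ} {A : ℂ[X][X]} {c : (Fin 3 →₀ ℕ) → ℂ} {u : ℂ}
    (h : A = ∑ m ∈ Idx d, C (C (c m) * (X - C u) ^ (m 1)) * X ^ (m 2)) {m : Fin 3 →₀ ℕ} (hm : m ∈ Idx d) :
    (m 1 = 0 → c m = (atU u A).coeff (m 2)) ∧ (m 1 = 1 → c m = (atU u (dU A)).coeff (m 2)) := by
  have key : ∀ m' ∈ Idx d, m' 1 = m 1 → m' 2 = m 2 → m' = m := by
    intro m' hm' h1 h2
    rw [mem_Idx] at hm hm'
    ext i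
    fin_cases i
    · show m' 0 = m 0
      omega
    · exact h1
    · exact h2
  have hc : ∀ k, A.coeff k = ∑ m ∈ Idx d, if k = m 2 then C (c m) * (X - C u) ^ (m 1) else 0 := by
    intro k
    rw [h, finsetSum_coeff]
    apply Finset.sum_congr rfl
    intro m _
    rw [coeff_C_mul, coeff_X_pow, mul_ite, mul_one, mul_zero]
  constructor
  · intro h1
    rw [coeff_map, hc, coe_evalRingHom, eval_finsetSum, Finset.sum_eq_single m]
    · simp [h1]
    · intro b hb hbm
      split_ifs with hk
      · have : b 1 ≠ 0 := fun h => hbm (key b hb (by omega) hk.symm)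
        simp [this]
      · simp
    · intro h; exact absurd hm h
  · intro h1
    rw [coeff_map, dU_coeff, hc, coe_evalRingHom, derivative_sum, eval_finsetSum, Finset.sum_eq_single m]
    · simp [h1]
    · intro b hb hbm
      split_ifs with hk
      · have : b 1 ≠ 1 := fun h => hbm (key b hb (by omega) hk.symm)
        rcases Nat.lt_or_ge (b 1) 1 with h0 | h0
        · have : b 1 = 0 := by omega
          simp [this]
        · have : b 1 - 1 ≠ 0 := by omega
          simp [derivative_pow, this]
      · simp
    · intro h; exact absurd hm h

open Polynomial in
lemma FH_natDegree {d : ℕ} {F : MvPolynomial (Fin 3) ℂ} (h : F.IsHomogeneous d) (ξ0 ξ1 : ℂ) : (FH F ξ0 ξ1).natDegree ≤ d := by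
  obtain ⟨c, -, hc⟩ := expand h ξ0 ξ1 0
  rw [hc]
  apply natDegree_sum_le_of_forall_le
  intro m hm
  refine (natDegree_C_mul_le _ _).trans ?_
  rw [mem_Idx] at hm
  rw [natDegree_X_pow]; omega

open Polynomial in
lemma FH_dU_degree {d : ℕ} {F : MvPolynomial (Fin 3) ℂ} (h : F.IsHomogeneous d) (ξ0 ξ1 u : ℂ) :
    (atU u (dU (FH F ξ0 ξ1))).degree < d := by
  obtain ⟨c, -, hc⟩ := expand h ξ0 ξ1 0
  rw [degree_lt_iff_coeff_zero]
  intro k hk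
  rw [coeff_map, dU_coeff, hc, finsetSum_coeff, derivative_sum, coe_evalRingHom, eval_finsetSum]
  apply Finset.sum_eq_zero
  intro m hm
  rw [mem_Idx] at hm
  rw [coeff_C_mul, coeff_X_pow]
  split_ifs with h'
  · have : m 1 = 0 := by omega
    simp [this]
  · simp

open Polynomial in
lemma FH_atU_degree {d : ℕ} {F : MvPolynomial (Fin 3) ℂ} (h : F.IsHomogeneous d) (ξ0 ξ1 u : ℂ) :
    (atU u (FH F ξ0 ξ1)).degree < (d + 1 : ℕ) := by
  rw [degree_lt_iff_coeff_zero]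
  intro k hk
  rw [coeff_map, coeff_eq_zero_of_natDegree_lt, map_zero]
  exact lt_of_le_of_lt (FH_natDegree h _ _) hk


open Polynomial in
def Thin (N : ℕ) (P : ℂ → ℂ[X] → ℂ[X] → ℂ[X] → ℂ[X] → Prop) : Prop :=
  ∃ (σ : Type) (_ : Fintype σ) (u : (σ → ℂ) → ℂ) (f g f1 g1 : (σ → ℂ) → ℂ[X]),
    PF u ∧ PF1 f ∧ PF1 g ∧ PF1 f1 ∧ PF1 g1 ∧ Fintype.card σ ≤ N ∧
    ∀ u' f' g' f1' g1', P u' f' g' f1' g1' → ∃ y, u' = u y ∧ f' = f y ∧ g' = g y ∧ f1' = f1 y ∧ g1' = g1 y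

open Polynomial in
lemma Thin.swap {N : ℕ} {P : ℂ → ℂ[X] → ℂ[X] → ℂ[X] → ℂ[X] → Prop} (h : Thin N P) :
    Thin N (fun u f g f1 g1 => P u g f g1 f1) := by
  obtain ⟨σ, i, u, f, g, f1, g1, hu, hf, hg, hf1, hg1, hc, h⟩ := h
  refine ⟨σ, i, u, g, f, g1, f1, hu, hg, hf, hg1, hf1, hc, fun u' f' g' f1' g1' hp => ?_⟩
  obtain ⟨y, h1, h2, h3, h4, h5⟩ := h _ _ _ _ _ hp
  exact ⟨y, h1, h3, h2, h5, h4⟩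

open Polynomial in
def PFam (n : ℕ) (f : (Fin n → ℂ) → ℂ[X] → ℂ[X] → ℂ[X] → ℂ[X] → ℂ[X]) : Prop :=
  ∀ (τ : Type) (s : Fin n → (τ → ℂ) → ℂ) (p1 p2 p3 p4 : (τ → ℂ) → ℂ[X]), (∀ i, PF (s i)) →
    PF1 p1 → PF1 p2 → PF1 p3 → PF1 p4 → PF1 (fun y => f (fun i => s i y) (p1 y) (p2 y) (p3 y) (p4 y))

open Polynomial in
lemma thin_mk {N : ℕ} {P : ℂ → ℂ[X] → ℂ[X] → ℂ[X] → ℂ[X] → Prop} (n k1 k2 k3 k4 : ℕ)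
    (hN : n + k1 + k2 + k3 + k4 ≤ N) (U : (Fin n → ℂ) → ℂ) (hU : PF U)
    (f g f1 g1 : (Fin n → ℂ) → ℂ[X] → ℂ[X] → ℂ[X] → ℂ[X] → ℂ[X])
    (hf : PFam n f) (hg : PFam n g) (hf1 : PFam n f1) (hg1 : PFam n g1)
    (hP : ∀ u' f' g' f1' g1', P u' f' g' f1' g1' → ∃ (s : Fin n → ℂ) (p1 p2 p3 p4 : ℂ[X]),
      p1.degree < k1 ∧ p2.degree < k2 ∧ p3.degree < k3 ∧ p4.degree < k4 ∧ u' = U s ∧ f' = f s p1 p2 p3 p4 ∧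
      g' = g s p1 p2 p3 p4 ∧ f1' = f1 s p1 p2 p3 p4 ∧ g1' = g1 s p1 p2 p3 p4) : Thin N P := by
  let τ := Fin n ⊕ (Fin k1 ⊕ (Fin k2 ⊕ (Fin k3 ⊕ Fin k4)))
  let e1 : Fin k1 → τ := fun i => Sum.inr (Sum.inl i)
  let e2 : Fin k2 → τ := fun i => Sum.inr (Sum.inr (Sum.inl i))
  let e3 : Fin k3 → τ := fun i => Sum.inr (Sum.inr (Sum.inr (Sum.inl i)))
  let e4 : Fin k4 → τ := fun i => Sum.inr (Sum.inr (Sum.inr (Sum.inr i)))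
  let ev : ((Fin n → ℂ) → ℂ[X] → ℂ[X] → ℂ[X] → ℂ[X] → ℂ[X]) → (τ → ℂ) → ℂ[X] := fun h y =>
    h (fun i => y (Sum.inl i)) (polyOf k1 fun i => y (e1 i)) (polyOf k2 fun i => y (e2 i))
      (polyOf k3 fun i => y (e3 i)) (polyOf k4 fun i => y (e4 i))
  have hev : ∀ h, PFam n h → PF1 (ev h) := fun h hh =>
    hh τ (fun i y => y (Sum.inl i)) _ _ _ _ (fun i => PF.proj _) (PF1.polyOf e1) (PF1.polyOf e2) (PF1.polyOf e3) (PF1.polyOf e4)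
  refine ⟨τ, inferInstance, fun y => U (y ∘ Sum.inl), ev f, ev g, ev f1, ev g1, hU.comp _, hev _ hf, hev _ hg, hev _ hf1, hev _ hg1, ?_, ?_⟩
  · simp only [τ, Fintype.card_sum, Fintype.card_fin]; omega
  · intro u' f' g' f1' g1' hp
    obtain ⟨s, p1, p2, p3, p4, d1, d2, d3, d4, h1, h2, h3, h4, h5⟩ := hP _ _ _ _ _ hp
    refine ⟨Sum.elim s (Sum.elim (fun i => p1.coeff i) (Sum.elim (fun i => p2.coeff i)
      (Sum.elim (fun i => p3.coeff i) (fun i => p4.coeff i)))), h1, ?_, ?_, ?_, ?_⟩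
    · simp only [ev, e1, e2, e3, e4, Sum.elim_inl, Sum.elim_inr, polyOf_surj d1, polyOf_surj d2, polyOf_surj d3, polyOf_surj d4]
      exact h2
    · simp only [ev, e1, e2, e3, e4, Sum.elim_inl, Sum.elim_inr, polyOf_surj d1, polyOf_surj d2, polyOf_surj d3, polyOf_surj d4]
      exact h3
    · simp only [ev, e1, e2, e3, e4, Sum.elim_inl, Sum.elim_inr, polyOf_surj d1, polyOf_surj d2, polyOf_surj d3, polyOf_surj d4]
      exact h4
    · simp only [ev, e1, e2, e3, e4, Sum.elim_inl, Sum.elim_inr, polyOf_surj d1, polyOf_surj d2, polyOf_surj d3, polyOf_surj d4]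
      exact h5

def FreeI (d : ℕ) : Finset (Fin 3 →₀ ℕ) := (Idx d).filter fun m => 2 ≤ m 1

lemma card_Idx_split (d : ℕ) :
    (FreeI d).card + (d + 1) + d ≤ (Idx d).card := by
  classical
  let mk : ℕ → ℕ → ℕ → (Fin 3 →₀ ℕ) := fun a b c => Finsupp.equivFunOnFinite.symm ![a, b, c]
  have c0 : d + 1 ≤ ((Idx d).filter fun m => m 1 = 0).card := by
    rw [← Finset.card_range (d + 1)]
    apply Finset.card_le_card_of_injOn (fun k => mk (d - k) 0 k)
    · intro k hk
      simp at hk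
      simp [mem_Idx, mk]; omega
    · intro k _ l _ h
      have := congrArg (fun m => m 2) h
      simpa [mk] using this
  have c1 : d ≤ ((Idx d).filter fun m => m 1 = 1).card := by
    conv_lhs => rw [← Finset.card_range d]
    apply Finset.card_le_card_of_injOn (fun k => mk (d - 1 - k) 1 k)
    · intro k hk
      simp at hk
      simp [mem_Idx, mk]; omega
    · intro k _ l _ h
      have := congrArg (fun m => m 2) h
      simpa [mk] using this
  have h1 := Finset.card_filter_add_card_filter_not (s := Idx d) (fun m => m 1 = 0)
  have h2 := Finset.card_filter_add_card_filter_not (s := (Idx d).filter fun m => ¬ m 1 = 0) (fun m => m 1 = 1)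
  rw [Finset.filter_filter, Finset.filter_filter] at h2
  have e1 : ((Idx d).filter fun m => ¬ m 1 = 0 ∧ m 1 = 1) = (Idx d).filter fun m => m 1 = 1 := by
    apply Finset.filter_congr; intro m _; omega
  have e2 : ((Idx d).filter fun m => ¬ m 1 = 0 ∧ ¬ m 1 = 1) = (Idx d).filter fun m => 2 ≤ m 1 := by
    apply Finset.filter_congr; intro m _; omega
  rw [e1, e2] at h2
  unfold FreeI
  omega

lemma PF3.bld {τ : Type} (d : ℕ) {c : (τ → ℂ) → (Fin 3 →₀ ℕ) → ℂ} {ξ0 ξ1 u : (τ → ℂ) → ℂ}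
    (hc : ∀ m, PF (fun y => c y m)) (h0 : PF ξ0) (h1 : PF ξ1) (hu : PF u) :
    PF3 (fun y => bld d (c y) (ξ0 y) (ξ1 y) (u y)) := by
  unfold _root_.bld
  apply PF3.sum
  intro m _
  exact (((PF3.C (hc m)).mul (((PF3.const _).sub ((PF3.C h0).mul (PF3.const _))).pow _)).mul
    ((((PF3.const _).sub ((PF3.C h1).mul (PF3.const _))).sub
      ((PF3.C hu).mul ((PF3.const _).sub ((PF3.C h0).mul (PF3.const _))))).pow _)).mul (PF3.const _)

abbrev IX (d : ℕ) := ({m // m ∈ Idx d} ⊕ {m // m ∈ Idx d}) ⊕ Fin 3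

def cvec (d : ℕ) (F G : MvPolynomial (Fin 3) ℂ) (x : Fin 3 → ℂ) : IX d → ℂ :=
  Sum.elim (Sum.elim (fun m => F.coeff m) (fun m => G.coeff m)) x

open Polynomial in
/-- the bad locus is contained in a hypersurface -/
def HasQ (d : ℕ) (π : Equiv.Perm (Fin 3)) (P : ℂ → ℂ[X] → ℂ[X] → ℂ[X] → ℂ[X] → Prop) : Prop :=
  ∃ Q : MvPolynomial (IX d) ℂ, Q ≠ 0 ∧ ∀ (F G : MvPolynomial (Fin 3) ℂ) (x : Fin 3 → ℂ) (ξ0 ξ1 t u : ℂ),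
    F.IsHomogeneous d → G.IsHomogeneous d → x ∘ π = ![t * ξ0, t * ξ1, t] →
    P u (atU u (FH (MvPolynomial.rename π F) ξ0 ξ1)) (atU u (FH (MvPolynomial.rename π G) ξ0 ξ1))
      (atU u (dU (FH (MvPolynomial.rename π F) ξ0 ξ1))) (atU u (dU (FH (MvPolynomial.rename π G) ξ0 ξ1))) →
    MvPolynomial.eval (cvec d F G x) Q = 0

open Polynomial in
lemma HasQ.or {d : ℕ} {π : Equiv.Perm (Fin 3)} {P P' : ℂ → ℂ[X] → ℂ[X] → ℂ[X] → ℂ[X] → Prop}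
    (h : HasQ d π P) (h' : HasQ d π P') : HasQ d π (fun u f g f1 g1 => P u f g f1 g1 ∨ P' u f g f1 g1) := by
  obtain ⟨Q, h0, hQ⟩ := h
  obtain ⟨Q', h0', hQ'⟩ := h'
  refine ⟨Q * Q', mul_ne_zero h0 h0', fun F G x ξ0 ξ1 t u hF hG hx hp => ?_⟩
  rw [map_mul]
  rcases hp with hp | hp
  · rw [hQ F G x ξ0 ξ1 t u hF hG hx hp, zero_mul]
  · rw [hQ' F G x ξ0 ξ1 t u hF hG hx hp, mul_zero]

open Polynomial in
lemma hasQ_of_thin {d : ℕ} (π : Equiv.Perm (Fin 3)) {P : ℂ → ℂ[X] → ℂ[X] → ℂ[X] → ℂ[X] → Prop}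
    (h : Thin (4 * d + 1) P) : HasQ d π P := by
  classical
  obtain ⟨σ, i, u, f, g, f1, g1, hu, hf, hg, hf1, hg1, hc, h⟩ := h
  let Fr := {m : Fin 3 →₀ ℕ // m ∈ FreeI d}
  let τ := σ ⊕ (Fin 3 ⊕ (Fr ⊕ Fr))
  let a0 : σ → τ := Sum.inl
  let ax : Fin 3 → τ := fun i => Sum.inr (Sum.inl i)
  let aF : Fr → τ := fun i => Sum.inr (Sum.inr (Sum.inl i))
  let aG : Fr → τ := fun i => Sum.inr (Sum.inr (Sum.inr i))
  let cc : ((σ → ℂ) → ℂ[X]) → ((σ → ℂ) → ℂ[X]) → (Fr → τ) → (τ → ℂ) → (Fin 3 →₀ ℕ) → ℂ := fun p p1 e y m =>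
    if m 1 = 0 then (p (y ∘ a0)).coeff (m 2) else if m 1 = 1 then (p1 (y ∘ a0)).coeff (m 2) else
      if h : m ∈ FreeI d then y (e ⟨m, h⟩) else 0
  have hcc : ∀ p p1 e, PF1 p → PF1 p1 → ∀ m, PF (fun y => cc p p1 e y m) := by
    intro p p1 e hp hp1 m
    simp only [cc]
    split_ifs
    · exact (hp _).comp a0
    · exact (hp1 _).comp a0
    · exact PF.proj _
    · exact PF.const 0
  let FF : ((σ → ℂ) → ℂ[X]) → ((σ → ℂ) → ℂ[X]) → (Fr → τ) → (τ → ℂ) → MvPolynomial (Fin 3) ℂ := fun p p1 e y =>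
    MvPolynomial.rename π.symm (bld d (cc p p1 e y) (y (ax 0)) (y (ax 1)) (u (y ∘ a0)))
  have hFF : ∀ p p1 e, PF1 p → PF1 p1 → PF3 (FF p p1 e) := fun p p1 e hp hp1 =>
    PF3.rename (PF3.bld d (hcc p p1 e hp hp1) (PF.proj _) (PF.proj _) (hu.comp a0)) _
  let xx : Fin 3 → (τ → ℂ) → ℂ := fun i y => (![y (ax 2) * y (ax 0), y (ax 2) * y (ax 1), y (ax 2)] : Fin 3 → ℂ) (π.symm i)
  have hxx : ∀ i, PF (xx i) := by
    intro i
    have : ∀ j : Fin 3, PF (fun y : τ → ℂ => (![y (ax 2) * y (ax 0), y (ax 2) * y (ax 1), y (ax 2)] : Fin 3 → ℂ) j) := by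
      intro j
      fin_cases j
      · exact (PF.proj (ax 2)).mul (PF.proj (ax 0))
      · exact (PF.proj (ax 2)).mul (PF.proj (ax 1))
      · exact PF.proj (ax 2)
    exact this _
  obtain ⟨Q, hQ0, hQ⟩ := exists_relation (τ := τ) (ι := IX d) (by
      have := card_Idx_split d
      simp only [τ, Fintype.card_sum, Fintype.card_fin, Fintype.card_coe, Fr]
      omega)
    (fun i y => cvec d (FF f f1 aF y) (FF g g1 aG y) (fun i => xx i y) i) (by
      rintro ((m | m) | j)
      · exact hFF f f1 aF hf hf1 m
      · exact hFF g g1 aG hg hg1 m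
      · exact hxx j)
  refine ⟨Q, hQ0, fun F G x ξ0 ξ1 t u' hF hG hx hp => ?_⟩
  obtain ⟨y0, e1, e2, e3, e4, e5⟩ := h _ _ _ _ _ hp
  obtain ⟨cF, hcF, hcF'⟩ := expand (hF.rename_isHomogeneous (f := π)) ξ0 ξ1 u'
  obtain ⟨cG, hcG, hcG'⟩ := expand (hG.rename_isHomogeneous (f := π)) ξ0 ξ1 u'
  let y : τ → ℂ := Sum.elim y0 (Sum.elim ![ξ0, ξ1, t] (Sum.elim (fun m => cF m.1) (fun m => cG m.1)))
  have hy0 : y ∘ a0 = y0 := rfl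
  have cong : ∀ c c' : (Fin 3 →₀ ℕ) → ℂ, (∀ m ∈ Idx d, c m = c' m) → bld d c ξ0 ξ1 u' = bld d c' ξ0 ξ1 u' := by
    intro c c' h
    unfold bld
    apply Finset.sum_congr rfl
    intro m hm
    rw [h m hm]
  have main : ∀ (H : MvPolynomial (Fin 3) ℂ) (cH : (Fin 3 →₀ ℕ) → ℂ) (p p1 : (σ → ℂ) → ℂ[X]) (e : Fr → τ),
      MvPolynomial.rename π H = bld d cH ξ0 ξ1 u' →
      FH (MvPolynomial.rename π H) ξ0 ξ1 = ∑ m ∈ Idx d, C (C (cH m) * (X - C u') ^ (m 1)) * X ^ (m 2) →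
      atU u' (FH (MvPolynomial.rename π H) ξ0 ξ1) = p y0 → atU u' (dU (FH (MvPolynomial.rename π H) ξ0 ξ1)) = p1 y0 →
      (∀ m, y (e m) = cH m.1) → FF p p1 e y = H := by
    intro H cH p p1 e h1 h2 h3 h4 h5
    have : H = MvPolynomial.rename π.symm (MvPolynomial.rename π H) := by
      rw [MvPolynomial.rename_rename]; simp
    rw [this, h1]
    show MvPolynomial.rename π.symm (bld d (cc p p1 e y) ξ0 ξ1 (u y0)) = _
    rw [← e1]
    refine congrArg (MvPolynomial.rename π.symm) (cong _ _ ?_)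
    intro m hm
    obtain ⟨k0, k1⟩ := expand_c h2 hm
    simp only [cc]
    split_ifs with i0 i1 i2
    · rw [k0 i0, h3]; rfl
    · rw [k1 i1, h4]; rfl
    · exact h5 _
    · exact absurd (Finset.mem_filter.2 ⟨hm, by omega⟩) i2
  have hFy := main F cF f f1 aF hcF hcF' e2 e4 (fun m => rfl)
  have hGy := main G cG g g1 aG hcG hcG' e3 e5 (fun m => rfl)
  have hxy : (fun i => xx i y) = x := by
    ext i
    have := congrFun hx (π.symm i)
    simp only [Function.comp_apply, Equiv.apply_symm_apply] at this
    rw [this]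
    rfl
  have := hQ y
  rw [hFy, hGy, hxy] at this
  exact this


open Polynomial in
lemma thin_fam1 {d : ℕ} (hd : 3 ≤ d) : Thin (4 * d + 1) (fun u f g f1 g1 => fam1 d f g ∧ f1.degree < d ∧ g1.degree < d) := by
  refine thin_mk 3 (d - 1) (d - 1) (d) (d) (by omega) (fun s => s 0) (PF.proj 0)
    (fun s p1 p2 p3 p4 => (X - C (s 1)) * (X - C (s 2)) * p1) (fun s p1 p2 p3 p4 => (X - C (s 1)) * (X - C (s 2)) * p2)
    (fun s p1 p2 p3 p4 => p3) (fun s p1 p2 p3 p4 => p4) ?_ ?_ ?_ ?_ ?_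
  iterate 4
    · intro τ s p1 p2 p3 p4 hs h1 h2 h3 h4
      repeat' first
        | assumption
        | exact hs _
        | with_reducible refine PF1.add ?_ ?_
        | with_reducible refine PF1.sub ?_ ?_
        | with_reducible refine PF1.mul ?_ ?_
        | with_reducible refine PF1.pow ?_ _
        | with_reducible refine PF1.C ?_
        | exact PF1.const _
  · rintro u f g f1 g1 ⟨⟨a, b, p, q, hp, hq, rfl, rfl⟩, hf1, hg1⟩
    refine ⟨![u, a, b], p, q, f1, g1, ?_, ?_, ?_, ?_, ?_, ?_, ?_, ?_, ?_⟩
    all_goals first | assumption | rfl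

open Polynomial in
lemma thin_fam2 {d : ℕ} (hd : 3 ≤ d) : Thin (4 * d + 1) (fun u f g f1 g1 => fam2 d f g ∧ f1.degree < d ∧ g1.degree < d) := by
  refine thin_mk 4 (d - 3) (d) (d) (d) (by omega) (fun s => s 0) (PF.proj 0)
    (fun s p1 p2 p3 p4 => C (s 3) * ((X - C (s 1)) * p2) + (X - C (s 1)) * (X - C (s 2)) ^ 3 * p1) (fun s p1 p2 p3 p4 => (X - C (s 1)) * p2)
    (fun s p1 p2 p3 p4 => p3) (fun s p1 p2 p3 p4 => p4) ?_ ?_ ?_ ?_ ?_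
  iterate 4
    · intro τ s p1 p2 p3 p4 hs h1 h2 h3 h4
      repeat' first
        | assumption
        | exact hs _
        | with_reducible refine PF1.add ?_ ?_
        | with_reducible refine PF1.sub ?_ ?_
        | with_reducible refine PF1.mul ?_ ?_
        | with_reducible refine PF1.pow ?_ _
        | with_reducible refine PF1.C ?_
        | exact PF1.const _
  · rintro u f g f1 g1 ⟨⟨a, b, c, p, q, hp, hq, rfl, rfl⟩, hf1, hg1⟩
    refine ⟨![u, a, b, c], p, q, f1, g1, ?_, ?_, ?_, ?_, ?_, ?_, ?_, ?_, ?_⟩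
    all_goals first | assumption | rfl

open Polynomial in
lemma thin_fam3 {d : ℕ} (hd : 3 ≤ d) : Thin (4 * d + 1) (fun u f g f1 g1 => fam3 d f g ∧ f1.degree < d ∧ g1.degree < d) := by
  refine thin_mk 3 (d - 2) (d) (d) (d) (by omega) (fun s => s 0) (PF.proj 0)
    (fun s p1 p2 p3 p4 => C (s 2) * ((X - C (s 1)) * p2) + (X - C (s 1)) ^ 3 * p1) (fun s p1 p2 p3 p4 => (X - C (s 1)) * p2)
    (fun s p1 p2 p3 p4 => p3) (fun s p1 p2 p3 p4 => p4) ?_ ?_ ?_ ?_ ?_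
  iterate 4
    · intro τ s p1 p2 p3 p4 hs h1 h2 h3 h4
      repeat' first
        | assumption
        | exact hs _
        | with_reducible refine PF1.add ?_ ?_
        | with_reducible refine PF1.sub ?_ ?_
        | with_reducible refine PF1.mul ?_ ?_
        | with_reducible refine PF1.pow ?_ _
        | with_reducible refine PF1.C ?_
        | exact PF1.const _
  · rintro u f g f1 g1 ⟨⟨a, c, p, q, hp, hq, rfl, rfl⟩, hf1, hg1⟩
    refine ⟨![u, a, c], p, q, f1, g1, ?_, ?_, ?_, ?_, ?_, ?_, ?_, ?_, ?_⟩
    all_goals first | assumption | rfl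

open Polynomial in
lemma thin_fam4 {d : ℕ} (hd : 3 ≤ d) : Thin (4 * d + 1) (fun u f g f1 g1 => fam4 d f g ∧ f1.degree < d ∧ g1.degree < d) := by
  refine thin_mk 5 (d - 2) (d - 2) (d) (d) (by omega) (fun s => s 0) (PF.proj 0)
    (fun s p1 p2 p3 p4 => (X - C (s 1)) ^ 3 * p1 + C (s 3) * ((X - C (s 2)) ^ 3 * p2)) (fun s p1 p2 p3 p4 => C (s 4) * ((X - C (s 1)) ^ 3 * p1) + (X - C (s 2)) ^ 3 * p2)
    (fun s p1 p2 p3 p4 => p3) (fun s p1 p2 p3 p4 => p4) ?_ ?_ ?_ ?_ ?_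
  iterate 4
    · intro τ s p1 p2 p3 p4 hs h1 h2 h3 h4
      repeat' first
        | assumption
        | exact hs _
        | with_reducible refine PF1.add ?_ ?_
        | with_reducible refine PF1.sub ?_ ?_
        | with_reducible refine PF1.mul ?_ ?_
        | with_reducible refine PF1.pow ?_ _
        | with_reducible refine PF1.C ?_
        | exact PF1.const _
  · rintro u f g f1 g1 ⟨⟨a, b, β, γ, p, q, hp, hq, rfl, rfl⟩, hf1, hg1⟩
    refine ⟨![u, a, b, β, γ], p, q, f1, g1, ?_, ?_, ?_, ?_, ?_, ?_, ?_, ?_, ?_⟩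
    all_goals first | assumption | rfl

open Polynomial in
lemma thin_fam6 {d : ℕ} (hd : 3 ≤ d) : Thin (4 * d + 1) (fun u f g f1 g1 => fam6 d f g ∧ f1.degree < d ∧ g1.degree < d) := by
  refine thin_mk 3 (d - 3) (d + 1) (d) (d) (by omega) (fun s => s 0) (PF.proj 0)
    (fun s p1 p2 p3 p4 => C (s 2) * p2 + (X - C (s 1)) ^ 4 * p1) (fun s p1 p2 p3 p4 => p2)
    (fun s p1 p2 p3 p4 => p3) (fun s p1 p2 p3 p4 => p4) ?_ ?_ ?_ ?_ ?_
  iterate 4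
    · intro τ s p1 p2 p3 p4 hs h1 h2 h3 h4
      repeat' first
        | assumption
        | exact hs _
        | with_reducible refine PF1.add ?_ ?_
        | with_reducible refine PF1.sub ?_ ?_
        | with_reducible refine PF1.mul ?_ ?_
        | with_reducible refine PF1.pow ?_ _
        | with_reducible refine PF1.C ?_
        | exact PF1.const _
  · rintro u f g f1 g1 ⟨⟨a, c, p, hp, hq, rfl⟩, hf1, hg1⟩
    refine ⟨![u, a, c], p, g, f1, g1, ?_, ?_, ?_, ?_, ?_, ?_, ?_, ?_, ?_⟩
    all_goals first | assumption | rfl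

open Polynomial in
lemma thin_fam7 {d : ℕ} (hd : 3 ≤ d) : Thin (4 * d + 1) (fun u f g f1 g1 => fam7 d f g ∧ f1.degree < d ∧ g1.degree < d) := by
  refine thin_mk 1 (d) (d) (d) (d) (by omega) (fun s => s 0) (PF.proj 0)
    (fun s p1 p2 p3 p4 => p1) (fun s p1 p2 p3 p4 => p2)
    (fun s p1 p2 p3 p4 => p3) (fun s p1 p2 p3 p4 => p4) ?_ ?_ ?_ ?_ ?_
  iterate 4
    · intro τ s p1 p2 p3 p4 hs h1 h2 h3 h4
      repeat' first
        | assumption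
        | exact hs _
        | with_reducible refine PF1.add ?_ ?_
        | with_reducible refine PF1.sub ?_ ?_
        | with_reducible refine PF1.mul ?_ ?_
        | with_reducible refine PF1.pow ?_ _
        | with_reducible refine PF1.C ?_
        | exact PF1.const _
  · rintro u f g f1 g1 ⟨⟨hp, hq⟩, hf1, hg1⟩
    refine ⟨![u], f, g, f1, g1, ?_, ?_, ?_, ?_, ?_, ?_, ?_, ?_, ?_⟩
    all_goals first | assumption | rfl

open Polynomial in
lemma thin_fam8 {d : ℕ} (hd : 3 ≤ d) : Thin (4 * d + 1) (fun u f g f1 g1 => fam8 d f g ∧ f1.degree < d ∧ g1.degree < d) := by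
  refine thin_mk 2 (d - 2) (d + 1) (d) (d) (by omega) (fun s => s 0) (PF.proj 0)
    (fun s p1 p2 p3 p4 => C (s 1) * p2 + p1) (fun s p1 p2 p3 p4 => p2)
    (fun s p1 p2 p3 p4 => p3) (fun s p1 p2 p3 p4 => p4) ?_ ?_ ?_ ?_ ?_
  iterate 4
    · intro τ s p1 p2 p3 p4 hs h1 h2 h3 h4
      repeat' first
        | assumption
        | exact hs _
        | with_reducible refine PF1.add ?_ ?_
        | with_reducible refine PF1.sub ?_ ?_
        | with_reducible refine PF1.mul ?_ ?_
        | with_reducible refine PF1.pow ?_ _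
        | with_reducible refine PF1.C ?_
        | exact PF1.const _
  · rintro u f g f1 g1 ⟨⟨c, p, hp, hq, rfl⟩, hf1, hg1⟩
    refine ⟨![u, c], p, g, f1, g1, ?_, ?_, ?_, ?_, ?_, ?_, ?_, ?_, ?_⟩
    all_goals first | assumption | rfl

open Polynomial in
lemma thin_fam9 {d : ℕ} (hd : 3 ≤ d) : Thin (4 * d + 1) (fun u f g f1 g1 => fam9 d f g f1 g1) := by
  refine thin_mk 6 (d - 2) (d - 1) (d - 2) (d) (by omega) (fun s => s 0) (PF.proj 0)
    (fun s p1 p2 p3 p4 => C (s 2) * (C (s 4) + C (s 5) * (X - C (s 1)) + (X - C (s 1)) ^ 2 * p2) + (X - C (s 1)) ^ 3 * p1) (fun s p1 p2 p3 p4 => C (s 4) + C (s 5) * (X - C (s 1)) + (X - C (s 1)) ^ 2 * p2)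
    (fun s p1 p2 p3 p4 => C (s 2) * p4 + C (s 3) * (C (s 4) + C (s 5) * (X - C (s 1))) + (X - C (s 1)) ^ 2 * p3) (fun s p1 p2 p3 p4 => p4) ?_ ?_ ?_ ?_ ?_
  iterate 4
    · intro τ s p1 p2 p3 p4 hs h1 h2 h3 h4
      repeat' first
        | assumption
        | exact hs _
        | with_reducible refine PF1.add ?_ ?_
        | with_reducible refine PF1.sub ?_ ?_
        | with_reducible refine PF1.mul ?_ ?_
        | with_reducible refine PF1.pow ?_ _
        | with_reducible refine PF1.C ?_
        | exact PF1.const _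
  · rintro u f g f1 g1 ⟨a, c, α, e0, e1, p, q, r, hp, hq, hr, hg, rfl, rfl, rfl⟩
    refine ⟨![u, a, c, α, e0, e1], p, q, r, g1, ?_, ?_, ?_, ?_, ?_, ?_, ?_, ?_, ?_⟩
    all_goals first | assumption | rfl

open Polynomial in
lemma thin_fam10 {d : ℕ} (hd : 3 ≤ d) : Thin (4 * d + 1) (fun u f g f1 g1 => fam10 d f g f1 g1) := by
  refine thin_mk 3 (d - 1) (d) (d - 1) (d) (by omega) (fun s => s 0) (PF.proj 0)
    (fun s p1 p2 p3 p4 => C (s 2) * ((X - C (s 1)) * p2) + (X - C (s 1)) ^ 2 * p1) (fun s p1 p2 p3 p4 => (X - C (s 1)) * p2)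
    (fun s p1 p2 p3 p4 => C (s 2) * p4 + (X - C (s 1)) * p3) (fun s p1 p2 p3 p4 => p4) ?_ ?_ ?_ ?_ ?_
  iterate 4
    · intro τ s p1 p2 p3 p4 hs h1 h2 h3 h4
      repeat' first
        | assumption
        | exact hs _
        | with_reducible refine PF1.add ?_ ?_
        | with_reducible refine PF1.sub ?_ ?_
        | with_reducible refine PF1.mul ?_ ?_
        | with_reducible refine PF1.pow ?_ _
        | with_reducible refine PF1.C ?_
        | exact PF1.const _
  · rintro u f g f1 g1 ⟨a, c, p, q, r, hp, hq, hr, hg, rfl, rfl, rfl⟩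
    refine ⟨![u, a, c], p, q, r, g1, ?_, ?_, ?_, ?_, ?_, ?_, ?_, ?_, ?_⟩
    all_goals first | assumption | rfl

open Polynomial in
lemma thin_fam11 {d : ℕ} (hd : 3 ≤ d) : Thin (4 * d + 1) (fun u f g f1 g1 => u = 0 ∧ fam11 d f g ∧ f1.degree < d ∧ g1.degree < d) := by
  refine thin_mk 1 (d) (d) (d) (d) (by omega) (fun s => 0) (PF.const 0)
    (fun s p1 p2 p3 p4 => (X - C (s 0)) * p1) (fun s p1 p2 p3 p4 => (X - C (s 0)) * p2)
    (fun s p1 p2 p3 p4 => p3) (fun s p1 p2 p3 p4 => p4) ?_ ?_ ?_ ?_ ?_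
  iterate 4
    · intro τ s p1 p2 p3 p4 hs h1 h2 h3 h4
      repeat' first
        | assumption
        | exact hs _
        | with_reducible refine PF1.add ?_ ?_
        | with_reducible refine PF1.sub ?_ ?_
        | with_reducible refine PF1.mul ?_ ?_
        | with_reducible refine PF1.pow ?_ _
        | with_reducible refine PF1.C ?_
        | exact PF1.const _
  · rintro u f g f1 g1 ⟨rfl, ⟨a, p, q, hp, hq, rfl, rfl⟩, hf1, hg1⟩
    refine ⟨![a], p, q, f1, g1, ?_, ?_, ?_, ?_, ?_, ?_, ?_, ?_, ?_⟩
    all_goals first | assumption | rfl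

open Polynomial in
lemma thin_fam12 {d : ℕ} (hd : 3 ≤ d) : Thin (4 * d + 1) (fun u f g f1 g1 => u = 0 ∧ fam12 d f g ∧ f1.degree < d ∧ g1.degree < d) := by
  refine thin_mk 2 (d - 2) (d + 1) (d) (d) (by omega) (fun s => 0) (PF.const 0)
    (fun s p1 p2 p3 p4 => C (s 1) * p2 + (X - C (s 0)) ^ 3 * p1) (fun s p1 p2 p3 p4 => p2)
    (fun s p1 p2 p3 p4 => p3) (fun s p1 p2 p3 p4 => p4) ?_ ?_ ?_ ?_ ?_
  iterate 4
    · intro τ s p1 p2 p3 p4 hs h1 h2 h3 h4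
      repeat' first
        | assumption
        | exact hs _
        | with_reducible refine PF1.add ?_ ?_
        | with_reducible refine PF1.sub ?_ ?_
        | with_reducible refine PF1.mul ?_ ?_
        | with_reducible refine PF1.pow ?_ _
        | with_reducible refine PF1.C ?_
        | exact PF1.const _
  · rintro u f g f1 g1 ⟨rfl, ⟨a, c, p, hp, hq, rfl⟩, hf1, hg1⟩
    refine ⟨![a, c], p, g, f1, g1, ?_, ?_, ?_, ?_, ?_, ?_, ?_, ?_, ?_⟩
    all_goals first | assumption | rfl

open Polynomial in
lemma thin_fam5 {d : ℕ} (hd : 3 ≤ d) : Thin (4 * d + 1) (fun u f g f1 g1 => fam5 d f g ∧ f1.degree < d ∧ g1.degree < d) := by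
  rcases Nat.lt_or_ge d 4 with h4 | h4
  · refine thin_mk 0 0 0 0 0 (by omega) (fun s => 0) (PF.const 0) (fun _ _ _ _ _ => 0) (fun _ _ _ _ _ => 0)
      (fun _ _ _ _ _ => 0) (fun _ _ _ _ _ => 0) ?_ ?_ ?_ ?_ ?_
    iterate 4
      · intro τ s p1 p2 p3 p4 hs h1 h2 h3 h4
        exact PF1.const 0
    · rintro u f g f1 g1 ⟨⟨h, _⟩, _⟩
      omega
  refine thin_mk 4 (d - 5) (d + 1) (d) (d) (by omega) (fun s => s 0) (PF.proj 0)
    (fun s p1 p2 p3 p4 => C (s 3) * p2 + (X - C (s 1)) ^ 3 * (X - C (s 2)) ^ 3 * p1) (fun s p1 p2 p3 p4 => p2)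
    (fun s p1 p2 p3 p4 => p3) (fun s p1 p2 p3 p4 => p4) ?_ ?_ ?_ ?_ ?_
  iterate 4
    · intro τ s p1 p2 p3 p4 hs h1 h2 h3 h4
      repeat' first
        | assumption
        | exact hs _
        | with_reducible refine PF1.add ?_ ?_
        | with_reducible refine PF1.sub ?_ ?_
        | with_reducible refine PF1.mul ?_ ?_
        | with_reducible refine PF1.pow ?_ _
        | with_reducible refine PF1.C ?_
        | exact PF1.const _
  · rintro u f g f1 g1 ⟨⟨_, a, b, c, p, hp, hq, rfl⟩, hf1, hg1⟩
    refine ⟨![u, a, b, c], p, g, f1, g1, ?_, ?_, ?_, ?_, ?_, ?_, ?_, ?_, ?_⟩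
    all_goals first | assumption | rfl

open Polynomial in
lemma HasQ.mono {d : ℕ} {π : Equiv.Perm (Fin 3)} {P P' : ℂ → ℂ[X] → ℂ[X] → ℂ[X] → ℂ[X] → Prop}
    (h : HasQ d π P) (hle : ∀ u f g f1 g1, P' u f g f1 g1 → P u f g f1 g1) : HasQ d π P' := by
  obtain ⟨Q, h0, hQ⟩ := h
  exact ⟨Q, h0, fun F G x ξ0 ξ1 t u hF hG hx hp => hQ F G x ξ0 ξ1 t u hF hG hx (hle _ _ _ _ _ hp)⟩

open Polynomial in
lemma hasQ_both {d : ℕ} (π : Equiv.Perm (Fin 3)) {P : ℂ → ℂ[X] → ℂ[X] → ℂ[X] → ℂ[X] → Prop}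
    (h : Thin (4 * d + 1) P) : HasQ d π (fun u f g f1 g1 => P u f g f1 g1 ∨ P u g f g1 f1) :=
  (hasQ_of_thin π h).or (hasQ_of_thin π h.swap)

open Polynomial in
lemma hasQ_BadQ {d : ℕ} (hd : 3 ≤ d) (π : Equiv.Perm (Fin 3)) :
    HasQ d π (fun _ f g f1 g1 => (f1.degree < d ∧ g1.degree < d) ∧ (BadQ d f g f1 g1 ∨ BadQ d g f g1 f1)) := by
  refine HasQ.mono ((hasQ_both π (thin_fam1 hd)).or ((hasQ_both π (thin_fam2 hd)).or ((hasQ_both π (thin_fam3 hd)).or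
    ((hasQ_both π (thin_fam4 hd)).or ((hasQ_both π (thin_fam5 hd)).or ((hasQ_both π (thin_fam6 hd)).or
    ((hasQ_both π (thin_fam7 hd)).or ((hasQ_both π (thin_fam8 hd)).or ((hasQ_both π (thin_fam9 hd)).or
    (hasQ_both π (thin_fam10 hd))))))))))) ?_
  rintro u f g f1 g1 ⟨⟨h1, h2⟩, h⟩
  simp only [h1, h2, and_true]
  unfold BadQ at h
  rcases h with (h | h | h | h | h | h | h | h | h | h) | (h | h | h | h | h | h | h | h | h | h) <;>
  simp only [h, true_or, or_true]

open Polynomial in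
lemma hasQ_BadI {d : ℕ} (hd : 3 ≤ d) (π : Equiv.Perm (Fin 3)) :
    HasQ d π (fun u f g f1 g1 => (u = 0 ∧ f1.degree < d ∧ g1.degree < d) ∧ (BadI d f g ∨ BadI d g f)) := by
  refine HasQ.mono ((hasQ_both π (thin_fam7 hd)).or ((hasQ_both π (thin_fam8 hd)).or ((hasQ_both π (thin_fam11 hd)).or
    (hasQ_both π (thin_fam12 hd))))) ?_
  rintro u f g f1 g1 ⟨⟨h0, h1, h2⟩, h⟩
  simp only [h0, h1, h2, and_true, true_and]
  unfold BadI at h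
  rcases h with (h | h | h | h) | (h | h | h | h) <;>
  simp only [h, true_or, or_true]

open Polynomial in
lemma exists_Q_good {d : ℕ} (hd : 3 ≤ d) : ∃ Q : MvPolynomial (IX d) ℂ, Q ≠ 0 ∧
    ∀ (F G : MvPolynomial (Fin 3) ℂ) (x : Fin 3 → ℂ), F.IsHomogeneous d → G.IsHomogeneous d →
      MvPolynomial.eval (cvec d F G x) Q ≠ 0 → x 2 ≠ 0 ∧ ∀ ξ0 ξ1, x = ![x 2 * ξ0, x 2 * ξ1, x 2] →
      (∀ u, GoodU d (atU u (FH F ξ0 ξ1)) (atU u (FH G ξ0 ξ1)) (atU u (dU (FH F ξ0 ξ1))) (atU u (dU (FH G ξ0 ξ1)))) ∧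
      GoodI d (atU 0 (FH (MvPolynomial.rename (Equiv.swap (0 : Fin 3) 1) F) ξ1 ξ0))
        (atU 0 (FH (MvPolynomial.rename (Equiv.swap (0 : Fin 3) 1) G) ξ1 ξ0)) := by
  obtain ⟨Q1, h1, hQ1⟩ := hasQ_BadQ hd 1
  obtain ⟨Q2, h2, hQ2⟩ := hasQ_BadI hd (Equiv.swap (0 : Fin 3) 1)
  refine ⟨Q1 * (Q2 * MvPolynomial.X (Sum.inr 2)), mul_ne_zero h1 (mul_ne_zero h2 (MvPolynomial.X_ne_zero _)), ?_⟩
  intro F G x hF hG hne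
  simp only [map_mul, MvPolynomial.eval_X] at hne
  have n1 := left_ne_zero_of_mul hne
  have n2 := left_ne_zero_of_mul (right_ne_zero_of_mul hne)
  have n3 : x 2 ≠ 0 := right_ne_zero_of_mul (right_ne_zero_of_mul hne)
  refine ⟨n3, fun ξ0 ξ1 hx => ⟨fun u => ?_, ?_⟩⟩
  · have : ¬ (BadQ d (atU u (FH F ξ0 ξ1)) (atU u (FH G ξ0 ξ1)) (atU u (dU (FH F ξ0 ξ1))) (atU u (dU (FH G ξ0 ξ1))) ∨
      BadQ d (atU u (FH G ξ0 ξ1)) (atU u (FH F ξ0 ξ1)) (atU u (dU (FH G ξ0 ξ1))) (atU u (dU (FH F ξ0 ξ1)))) := by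
      intro hb
      apply n1
      have hr : ∀ H : MvPolynomial (Fin 3) ℂ, MvPolynomial.rename (1 : Equiv.Perm (Fin 3)) H = H := fun H => by
        rw [Equiv.Perm.coe_one, MvPolynomial.rename_id_apply]
      apply hQ1 F G x ξ0 ξ1 (x 2) u hF hG
      · rw [Equiv.Perm.coe_one, Function.comp_id]; exact hx
      · rw [hr, hr]
        exact ⟨⟨FH_dU_degree hF _ _ _, FH_dU_degree hG _ _ _⟩, hb⟩
    push Not at this
    exact goodU_of hd (FH_atU_degree hF _ _ _) (FH_atU_degree hG _ _ _) (FH_dU_degree hF _ _ _) (FH_dU_degree hG _ _ _) this.1 this.2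
  · have hF' := hF.rename_isHomogeneous (f := Equiv.swap (0 : Fin 3) 1)
    have hG' := hG.rename_isHomogeneous (f := Equiv.swap (0 : Fin 3) 1)
    by_contra hcon
    apply n2
    apply hQ2 F G x ξ1 ξ0 (x 2) 0 hF hG
    · rw [hx]
      ext i; fin_cases i <;> rfl
    · refine ⟨⟨rfl, FH_dU_degree hF' _ _ _, FH_dU_degree hG' _ _ _⟩, ?_⟩
      by_contra hb
      push Not at hb
      exact hcon (goodI_of hd (FH_atU_degree hF' _ _ _) (FH_atU_degree hG' _ _ _) hb.1 hb.2)


open Polynomial in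
lemma aeval_smul_hom {A : Type*} [CommRing A] [Algebra ℂ A] {d : ℕ} {F : MvPolynomial (Fin 3) ℂ} (h : F.IsHomogeneous d)
    (a : A) (p : Fin 3 → A) : MvPolynomial.aeval (fun i => a * p i) F = a ^ d * MvPolynomial.aeval p F := by
  rw [hom_sum h, map_sum, map_sum, Finset.mul_sum]
  apply Finset.sum_congr rfl
  intro m hm
  rw [mem_Idx] at hm
  simp only [map_mul, map_pow, MvPolynomial.aeval_X, MvPolynomial.algHom_C]
  rw [← hm, pow_add, pow_add]
  ring

open Polynomial in
lemma linePoly_comp (F : MvPolynomial (Fin 3) ℂ) (v w : Fin 3 → ℂ) (r : ℂ[X]) :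
    (linePoly F v w).comp r = MvPolynomial.aeval (fun i => C (v i) + r * C (w i)) F := by
  unfold linePoly
  have : ∀ q : ℂ[X], q.comp r = (Polynomial.aeval r : ℂ[X] →ₐ[ℂ] ℂ[X]) q := fun q => rfl
  rw [this, ← AlgHom.comp_apply, MvPolynomial.comp_aeval]
  congr 2
  ext1 i
  simp
  exact mul_comm _ _

open Polynomial in
lemma linePoly_natDegree {d : ℕ} {F : MvPolynomial (Fin 3) ℂ} (h : F.IsHomogeneous d) (v w : Fin 3 → ℂ) :
    (linePoly F v w).natDegree ≤ d := by
  unfold linePoly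
  rw [hom_sum h, map_sum]
  apply natDegree_sum_le_of_forall_le
  intro m hm
  rw [mem_Idx] at hm
  have h1 : ∀ i, (C (v i) + X * C (w i)).natDegree ≤ 1 := by
    intro i
    compute_degree
  have h2 : ∀ i, ((C (v i) + X * C (w i)) ^ (m i)).natDegree ≤ m i := by
    intro i
    refine natDegree_pow_le.trans ?_
    exact (Nat.mul_le_mul_left _ (h1 i)).trans (by simp)
  simp only [map_mul, map_pow, MvPolynomial.aeval_X]
  rw [show (MvPolynomial.aeval (R := ℂ) fun i => C (v i) + X * C (w i)) (MvPolynomial.C (MvPolynomial.coeff m F)) =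
    C (F.coeff m) from MvPolynomial.aeval_C _ _]
  rw [← hm]
  refine natDegree_mul_le.trans (Nat.add_le_add (natDegree_mul_le.trans (Nat.add_le_add (natDegree_mul_le.trans ?_) (h2 1))) (h2 2))
  rw [natDegree_C, zero_add]; exact h2 0

lemma fsimp1 {K : Type*} [Field K] (a b x y : K) (ha : a ≠ 0) : a * x + b * y = a * (x + b / a * y) := by
  field_simp
lemma fsimp2 {K : Type*} [Field K] (a b c : K) (n k : ℕ) (ha : a ≠ 0) :
    a ^ n * a ^ k * (c * (b ^ k / a ^ k)) = c * a ^ n * b ^ k := by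
  field_simp

open Polynomial in
lemma linePoly_homog {d : ℕ} {F : MvPolynomial (Fin 3) ℂ} (h : F.IsHomogeneous d) (v w : Fin 3 → ℂ) (A B : ℂ[X]) (hA : A ≠ 0) :
    MvPolynomial.aeval (fun i => A * C (v i) + B * C (w i)) F =
      ∑ k ∈ Finset.range (d + 1), C ((linePoly F v w).coeff k) * A ^ (d - k) * B ^ k := by
  let K := FractionRing ℂ[X]
  let ι : ℂ[X] →ₐ[ℂ] K := IsScalarTower.toAlgHom ℂ ℂ[X] K
  have hι : Function.Injective ι := IsFractionRing.injective ℂ[X] K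
  have hA' : ι A ≠ 0 := fun h0 => hA (hι (by rw [h0, map_zero]))
  apply hι
  have e1 : ι (MvPolynomial.aeval (fun i => A * C (v i) + B * C (w i)) F) =
      (ι A) ^ d * MvPolynomial.aeval (fun i => algebraMap ℂ K (v i) + (ι B / ι A) * algebraMap ℂ K (w i)) F := by
    rw [← aeval_smul_hom h, ← AlgHom.comp_apply, MvPolynomial.comp_aeval]
    congr 2
    ext1 i
    have hc : ∀ a : ℂ, ι (C a) = algebraMap ℂ K a := fun a => ι.commutes a
    simp only [map_add, map_mul, hc]
    exact fsimp1 _ _ _ _ hA'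
  have e2 : MvPolynomial.aeval (fun i => algebraMap ℂ K (v i) + (ι B / ι A) * algebraMap ℂ K (w i)) F =
      Polynomial.aeval (ι B / ι A) (linePoly F v w) := by
    unfold linePoly
    rw [← AlgHom.comp_apply (Polynomial.aeval (ι B / ι A)), MvPolynomial.comp_aeval]
    congr 2
    ext1 i
    simp
    exact mul_comm _ _
  rw [e1, e2, aeval_eq_sum_range' (Nat.lt_succ_of_le (linePoly_natDegree h v w)), map_sum, Finset.mul_sum]
  apply Finset.sum_congr rfl
  intro k hk
  have hk' : k ≤ d := by simpa [Nat.lt_succ_iff] using hk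
  have hc : ∀ a : ℂ, ι (C a) = algebraMap ℂ K a := fun a => ι.commutes a
  rw [map_mul, map_mul, map_pow, map_pow, hc, Algebra.smul_def, ← Nat.sub_add_cancel hk', pow_add, Nat.add_sub_cancel, div_pow]
  exact fsimp2 _ _ _ _ _ hA'

open Polynomial in
lemma contact_change {d : ℕ} {F : MvPolynomial (Fin 3) ℂ} (h : F.IsHomogeneous d) {v w : Fin 3 → ℂ} (hc : ContactLE F v w 3) (c : ℂ) :
    ContactLE F v (w + c • v) 3 := by
  unfold ContactLE at *
  have : linePoly F v (w + c • v) = MvPolynomial.aeval (fun i => (1 + C c * X) * C (v i) + X * C (w i)) F := by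
    unfold linePoly
    congr 2
    ext1 i
    simp
    ring
  rw [this, linePoly_homog h v w _ _ (by
    intro h0
    have := congrArg (eval 0) h0
    simp at this)]
  apply Finset.dvd_sum
  intro k _
  rcases Nat.lt_or_ge k 3 with hk | hk
  · rw [X_pow_dvd_iff.1 hc k hk]; simp
  · exact Dvd.dvd.mul_left (pow_dvd_pow _ hk) _

open Polynomial in
/-- contact at a point different from the centre -/
lemma contact_fin {d : ℕ} {F : MvPolynomial (Fin 3) ℂ} (h : F.IsHomogeneous d) {e x : Fin 3 → ℂ} {α β γ δ : ℂ}
    (hα : α ≠ 0) (hdet : α * δ - β * γ ≠ 0) (hc : ContactLE F (α • e + β • x) (γ • e + δ • x) 3) :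
    (X - C (β / α)) ^ 3 ∣ linePoly F e x := by
  have h1 := contact_change h hc (-γ / α)
  have hw : γ • e + δ • x + (-γ / α) • (α • e + β • x) = ((α * δ - β * γ) / α) • x := by
    ext i
    simp
    field_simp
    ring
  rw [hw] at h1
  set κ := (α * δ - β * γ) / α with hκ
  have hκ0 : κ ≠ 0 := div_ne_zero hdet hα
  unfold ContactLE at h1
  have e1 : linePoly F (α • e + β • x) (κ • x) = C (α ^ d) * (linePoly F e x).comp (C (β / α) + C (κ / α) * X) := by
    rw [linePoly_comp, C_pow, ← aeval_smul_hom h]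
    unfold linePoly
    congr 2
    ext1 i
    have h1 : (C α : ℂ[X]) * C (β / α) = C β := by rw [← C_mul]; congr 1; field_simp
    have h2 : (C α : ℂ[X]) * C (κ / α) = C κ := by rw [← C_mul]; congr 1; field_simp
    simp only [Pi.add_apply, Pi.smul_apply, smul_eq_mul, C_add, C_mul]
    linear_combination (-C (x i)) * h1 - (X * C (x i)) * h2
  rw [e1] at h1
  have h2 : (X : ℂ[X]) ^ 3 ∣ (linePoly F e x).comp (C (β / α) + C (κ / α) * X) := by
    have hu : IsUnit (C (α ^ d) : ℂ[X]) := isUnit_C.2 (pow_ne_zero _ hα).isUnit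
    exact (hu.dvd_mul_left).1 h1
  obtain ⟨r, hr⟩ := h2
  have h3 := congrArg (fun q => q.comp (C (α / κ) * (X - C (β / α)))) hr
  simp only [comp_assoc, mul_comp, pow_comp, X_comp] at h3
  have h4 : (C (β / α) + C (κ / α) * X : ℂ[X]).comp (C (α / κ) * (X - C (β / α))) = X := by
    simp only [add_comp, mul_comp, C_comp, X_comp]
    have : (C (κ / α) : ℂ[X]) * C (α / κ) = 1 := by rw [← C_mul, ← C_1]; congr 1; field_simp
    linear_combination (X - C (β / α)) * this
  rw [h4, comp_X] at h3
  rw [h3, mul_pow]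
  exact Dvd.dvd.mul_right (Dvd.dvd.mul_left dvd_rfl _) _

open Polynomial in
/-- contact at the centre -/
lemma contact_inf {d : ℕ} (hd : 3 ≤ d) {F : MvPolynomial (Fin 3) ℂ} (h : F.IsHomogeneous d) {e x : Fin 3 → ℂ} {β γ δ : ℂ}
    (hdet : β * γ ≠ 0) (hc : ContactLE F (β • x) (γ • e + δ • x) 3) :
    (linePoly F e x).degree < (d - 2 : ℕ) := by
  have hβ := left_ne_zero_of_mul hdet
  have hγ := right_ne_zero_of_mul hdet
  have h1 := contact_change h hc (-δ / β)
  have hw : γ • e + δ • x + (-δ / β) • (β • x) = γ • e := by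
    ext i
    simp
    field_simp
    ring
  rw [hw] at h1
  unfold ContactLE at h1
  have e1 : linePoly F (β • x) (γ • e) = MvPolynomial.aeval (fun i => (C γ * X) * C (e i) + C β * C (x i)) F := by
    unfold linePoly
    congr 2
    ext1 i
    simp
    ring
  rw [e1, linePoly_homog h _ _ _ _ (mul_ne_zero (C_ne_zero.2 hγ) X_ne_zero)] at h1
  rw [degree_lt_iff_coeff_zero]
  intro k hk
  rcases Nat.lt_or_ge d k with hkd | hkd
  · exact coeff_eq_zero_of_natDegree_lt (lt_of_le_of_lt (linePoly_natDegree h _ _) hkd)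
  have h2 := X_pow_dvd_iff.1 h1 (d - k) (by omega)
  rw [finsetSum_coeff, Finset.sum_eq_single k] at h2
  · rw [mul_pow, ← C_pow, ← C_pow, show C ((linePoly F e x).coeff k) * (C (γ ^ (d - k)) * X ^ (d - k)) * C (β ^ k) =
      C ((linePoly F e x).coeff k * γ ^ (d - k) * β ^ k) * X ^ (d - k) by simp only [C_mul]; ring, coeff_C_mul, coeff_X_pow_self] at h2
    simpa [hβ, hγ] using h2
  · intro b hb hbk
    have hb' : b ≤ d := by simpa [Nat.lt_succ_iff] using hb
    rw [mul_pow, ← C_pow, ← C_pow, show C ((linePoly F e x).coeff b) * (C (γ ^ (d - b)) * X ^ (d - b)) * C (β ^ b) =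
      C ((linePoly F e x).coeff b * γ ^ (d - b) * β ^ b) * X ^ (d - b) by simp only [C_mul]; ring, coeff_C_mul, coeff_X_pow, if_neg (by omega), mul_zero]
  · intro hk'
    exact absurd (Finset.mem_range.2 (by omega)) hk'


open Polynomial in
lemma atU_FH (F : MvPolynomial (Fin 3) ℂ) (ξ0 ξ1 u : ℂ) :
    atU u (FH F ξ0 ξ1) = linePoly F ![1, u, 0] ![ξ0, ξ1, 1] := by
  have h0 : ∀ A : ℂ[X][X], atU u A = (Polynomial.mapAlgHom (Polynomial.aeval (R := ℂ) u)) A := fun A => by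
    rw [Polynomial.coe_mapAlgHom]; rfl
  unfold linePoly FH
  rw [h0, ← AlgHom.comp_apply, MvPolynomial.comp_aeval]
  congr 2
  ext1 i
  fin_cases i <;> simp <;> ring

open Polynomial in
lemma atU_FHs (F : MvPolynomial (Fin 3) ℂ) (ξ0 ξ1 v : ℂ) :
    atU v (FH (MvPolynomial.rename (Equiv.swap (0 : Fin 3) 1) F) ξ1 ξ0) = linePoly F ![v, 1, 0] ![ξ0, ξ1, 1] := by
  rw [atU_FH]
  unfold linePoly
  rw [MvPolynomial.aeval_rename]
  congr 2
  ext1 i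
  fin_cases i <;> rfl

open Polynomial in
lemma FH_scale {d : ℕ} {F : MvPolynomial (Fin 3) ℂ} (h : F.IsHomogeneous d) (ξ0 ξ1 v : ℂ) (hv : v ≠ 0) :
    atU v (FH (MvPolynomial.rename (Equiv.swap (0 : Fin 3) 1) F) ξ1 ξ0) =
      C (v ^ d) * (atU v⁻¹ (FH F ξ0 ξ1)).comp (C v⁻¹ * X) := by
  rw [atU_FHs, atU_FH, linePoly_comp, C_pow, ← aeval_smul_hom h]
  unfold linePoly
  congr 2
  ext1 i
  have : (C v : ℂ[X]) * C v⁻¹ = 1 := by rw [← C_mul, mul_inv_cancel₀ hv, C_1]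
  fin_cases i
  · simp
    linear_combination (-X * C ξ0) * this
  · simp
    linear_combination (-X * C ξ1 - 1) * this
  · simp
    linear_combination (-X) * this

open Polynomial in
lemma linePoly_lin (F G : MvPolynomial (Fin 3) ℂ) (a b : ℂ) (v w : Fin 3 → ℂ) :
    linePoly (a • F + b • G) v w = C a * linePoly F v w + C b * linePoly G v w := by
  unfold linePoly
  rw [map_add, map_smul, map_smul, smul_eq_C_mul, smul_eq_C_mul]

open Polynomial in
lemma J_inf_contra {d : ℕ} (hd : 3 ≤ d) {f g : ℂ[X]} (hf : f.natDegree ≤ d) (hg : g.natDegree ≤ d) {l μ : ℂ}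
    (hl : l ≠ 0 ∨ μ ≠ 0) (h : (C l * f + C μ * g).degree < (d - 2 : ℕ)) :
    (JJ f g).coeff (2 * d - 2) = 0 ∧ (JJ f g).coeff (2 * d - 3) = 0 := by
  have hn : (C l * f + C μ * g).natDegree ≤ d - 3 := by
    rw [natDegree_le_iff_coeff_eq_zero]
    intro k hk
    exact (degree_lt_iff_coeff_zero _ _).1 h k (by omega)
  have key : ∀ q : ℂ[X], q.natDegree ≤ d → (JJ (C l * f + C μ * g) q).natDegree ≤ 2 * d - 4 := by
    intro q hq
    unfold JJ
    apply (natDegree_sub_le _ _).trans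
    apply max_le
    · refine natDegree_mul_le.trans ((Nat.add_le_add hn ((natDegree_derivative_le _).trans (Nat.sub_le_sub_right hq 1))).trans (by omega))
    · rcases Nat.eq_zero_or_pos (C l * f + C μ * g).natDegree with h0 | h0
      · rw [eq_C_of_natDegree_eq_zero h0]; simp
      · refine natDegree_mul_le.trans ((Nat.add_le_add (natDegree_derivative_le _) hq).trans (by omega))
  rcases hl with hl | hl
  · have e : JJ (C l * f + C μ * g) g = C l * JJ f g := by unfold JJ; simp; ring
    have k := key g hg
    rw [e, natDegree_C_mul hl] at k
    exact ⟨coeff_eq_zero_of_natDegree_lt (by omega), coeff_eq_zero_of_natDegree_lt (by omega)⟩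
  · have e : JJ (C l * f + C μ * g) f = C (-μ) * JJ f g := by unfold JJ; simp; ring
    have k := key f hf
    rw [e, natDegree_C_mul (neg_ne_zero.2 hl)] at k
    exact ⟨coeff_eq_zero_of_natDegree_lt (by omega), coeff_eq_zero_of_natDegree_lt (by omega)⟩

lemma linInd_e {a b ξ0 ξ1 : ℂ} (h : a ≠ 0 ∨ b ≠ 0) : LinearIndependent ℂ ![![a, b, 0], ![ξ0, ξ1, 1]] := by
  rw [LinearIndependent.pair_iff]
  intro s t hst
  have h0 := congrFun hst 0
  have h1 := congrFun hst 1
  have h2 := congrFun hst 2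
  simp at h0 h1 h2
  subst h2
  simp at h0 h1
  rcases h with h | h
  · exact ⟨by simpa [h] using h0, rfl⟩
  · exact ⟨by simpa [h] using h1, rfl⟩

lemma finrank_pair {e x : Fin 3 → ℂ} (h : LinearIndependent ℂ ![e, x]) :
    Module.finrank ℂ (Submodule.span ℂ {e, x} : Submodule ℂ (Fin 3 → ℂ)) = 2 := by
  have := finrank_span_eq_card h
  have hr : Set.range ![e, x] = {e, x} := by
    ext z
    simp [eq_comm]
    exact or_comm
  rw [hr] at this
  simpa using this

/-- structure of lines through a point outside the line at infinity -/
lemma line_struct {W : Submodule ℂ (Fin 3 → ℂ)} {ξ0 ξ1 : ℂ} (hx : ![ξ0, ξ1, 1] ∈ W) (hW : Module.finrank ℂ W = 2)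
    {v w : Fin 3 → ℂ} (hv : v ∈ W) (hw : w ∈ W) (hvw : LinearIndependent ℂ ![v, w]) :
    (∃ u : ℂ, W = Submodule.span ℂ {![1, u, 0], ![ξ0, ξ1, 1]}) ∨ W = Submodule.span ℂ {![0, 1, 0], ![ξ0, ξ1, 1]} := by
  have key : ∀ a b : ℂ, (a ≠ 0 ∨ b ≠ 0) → ![a, b, 0] ∈ W → W = Submodule.span ℂ {![a, b, 0], ![ξ0, ξ1, 1]} := by
    intro a b hab he
    symm
    apply Submodule.eq_of_le_of_finrank_eq
    · rw [Submodule.span_le]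
      rintro z (rfl | rfl)
      · exact he
      · exact hx
    · rw [finrank_pair (linInd_e hab), hW]
  have key2 : ∀ a b : ℂ, (a ≠ 0 ∨ b ≠ 0) → ![a, b, 0] ∈ W →
      (∃ u : ℂ, W = Submodule.span ℂ {![1, u, 0], ![ξ0, ξ1, 1]}) ∨ W = Submodule.span ℂ {![0, 1, 0], ![ξ0, ξ1, 1]} := by
    intro a b hab he
    by_cases ha : a = 0
    · right
      have hb : b ≠ 0 := by simpa [ha] using hab
      apply key 0 1 (by simp)
      have := W.smul_mem b⁻¹ he
      convert this using 1
      ext i; fin_cases i <;> simp [ha, hb]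
    · left
      refine ⟨b / a, key 1 (b / a) (by simp) ?_⟩
      have := W.smul_mem a⁻¹ he
      convert this using 1
      ext i; fin_cases i <;> simp [ha]
      field_simp
  have hv' : ∀ v ∈ W, ![v 0 - v 2 * ξ0, v 1 - v 2 * ξ1, 0] ∈ W := by
    intro v hv
    have := W.sub_mem hv (W.smul_mem (v 2) hx)
    convert this using 1
    ext i; fin_cases i <;> simp
  by_cases h1 : v 0 - v 2 * ξ0 ≠ 0 ∨ v 1 - v 2 * ξ1 ≠ 0
  · exact key2 _ _ h1 (hv' v hv)
  by_cases h2 : w 0 - w 2 * ξ0 ≠ 0 ∨ w 1 - w 2 * ξ1 ≠ 0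
  · exact key2 _ _ h2 (hv' w hw)
  exfalso
  push Not at h1 h2
  rw [LinearIndependent.pair_iff] at hvw
  have hv2 : v = v 2 • ![ξ0, ξ1, 1] := by
    ext i; fin_cases i <;> simp
    · linear_combination h1.1
    · linear_combination h1.2
  have hw2 : w = w 2 • ![ξ0, ξ1, 1] := by
    ext i; fin_cases i <;> simp
    · linear_combination h2.1
    · linear_combination h2.2
  have h3 := hvw (w 2) (-v 2) (by
    rw [hv2, hw2]; ext i; fin_cases i <;> simp <;> ring)
  have h4 := hvw 1 0 (by rw [hv2, neg_eq_zero.1 h3.2]; simp)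
  exact one_ne_zero h4.1

lemma pair_det {e x : Fin 3 → ℂ} {α β γ δ : ℂ} (h : LinearIndependent ℂ ![α • e + β • x, γ • e + δ • x]) :
    α * δ - β * γ ≠ 0 := by
  intro h0
  rw [LinearIndependent.pair_iff] at h
  have h1 := h δ (-β) (by
    ext i; simp; linear_combination (e i) * h0)
  have h2 := h γ (-α) (by
    ext i; simp; linear_combination (-x i) * h0)
  have h3 := h 1 0 (by
    ext i; simp [neg_eq_zero.1 h1.2, neg_eq_zero.1 h2.2])
  exact one_ne_zero h3.1


open Polynomial in
lemma pencil_hom {d : ℕ} {F G : MvPolynomial (Fin 3) ℂ} (hF : F.IsHomogeneous d) (hG : G.IsHomogeneous d) (a b : ℂ) :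
    (a • F + b • G).IsHomogeneous d := by
  rw [MvPolynomial.smul_eq_C_mul, MvPolynomial.smul_eq_C_mul]
  have h := fun c : ℂ => MvPolynomial.isHomogeneous_C (Fin 3) c
  refine MvPolynomial.IsHomogeneous.add ?_ ?_
  · simpa using (h a).mul hF
  · simpa using (h b).mul hG

open Polynomial in
lemma flex_count {d : ℕ} (hd : 3 ≤ d) {F G : MvPolynomial (Fin 3) ℂ} (hF : F.IsHomogeneous d) (hG : G.IsHomogeneous d)
    {x : Fin 3 → ℂ} {ξ0 ξ1 : ℂ} (hx2 : x 2 ≠ 0) (hx : x = ![x 2 * ξ0, x 2 * ξ1, x 2])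
    (hgood : ∀ u, GoodU d (atU u (FH F ξ0 ξ1)) (atU u (FH G ξ0 ξ1)) (atU u (dU (FH F ξ0 ξ1))) (atU u (dU (FH G ξ0 ξ1))))
    (hI : GoodI d (atU 0 (FH (MvPolynomial.rename (Equiv.swap (0 : Fin 3) 1) F) ξ1 ξ0))
        (atU 0 (FH (MvPolynomial.rename (Equiv.swap (0 : Fin 3) 1) G) ξ1 ξ0))) :
    (flexLinesThrough F G x).Finite ∧ ((flexLinesThrough F G x).ncard : ℤ) = 3 * (d : ℤ) * ((d : ℤ) - 2) := by
  classical
  have hF' := hF.rename_isHomogeneous (f := Equiv.swap (0 : Fin 3) 1)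
  have hG' := hG.rename_isHomogeneous (f := Equiv.swap (0 : Fin 3) 1)
  obtain ⟨S, hS, hmem⟩ := count_flex hd _ _ _ _ (FH_natDegree hF ξ0 ξ1) (FH_natDegree hG ξ0 ξ1)
    (FH_natDegree hF' ξ1 ξ0) (FH_natDegree hG' ξ1 ξ0) (FH_scale hF ξ0 ξ1) (FH_scale hG ξ0 ξ1) hgood hI
  let L : ℂ → Submodule ℂ (Fin 3 → ℂ) := fun u => Submodule.span ℂ {![1, u, 0], ![ξ0, ξ1, 1]}
  have hxe : x = x 2 • ![ξ0, ξ1, 1] := by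
    conv_lhs => rw [hx]
    ext i; fin_cases i <;> simp
  have hLinj : Function.Injective L := by
    intro u u' h
    have h1 : ![1, u, 0] ∈ L u' := by
      rw [← h]; exact Submodule.subset_span (by simp)
    obtain ⟨a, b, hab⟩ := Submodule.mem_span_pair.1 h1
    have h0 := congrFun hab 0
    have h1 := congrFun hab 1
    have h2 := congrFun hab 2
    simp at h0 h1 h2
    subst h2
    simp at h0 h1
    rw [← h1, h0, one_mul]
  have hset : flexLinesThrough F G x = ↑(S.image L) := by
    ext W
    rw [Finset.mem_coe, Finset.mem_image]
    constructor
    · rintro ⟨hxW, hW, c, v, w, hv, hw, hvw, hc⟩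
      have hxW' : ![ξ0, ξ1, 1] ∈ W := by
        have := W.smul_mem (x 2)⁻¹ hxW
        rwa [hxe, smul_smul, show ((x 2 • ![ξ0, ξ1, 1] : Fin 3 → ℂ) 2) = x 2 by simp, inv_mul_cancel₀ hx2, one_smul] at this
      have hc0 : c.rep 0 ≠ 0 ∨ c.rep 1 ≠ 0 := by
        by_contra hcon
        push Not at hcon
        apply c.rep_nonzero
        ext i; fin_cases i
        · exact hcon.1
        · exact hcon.2
      have hh := pencil_hom hF hG (c.rep 0) (c.rep 1)
      have main : ∀ e : Fin 3 → ℂ, W = Submodule.span ℂ {e, ![ξ0, ξ1, 1]} →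
          (∃ z, (X - C z) ^ 3 ∣ C (c.rep 0) * linePoly F e ![ξ0, ξ1, 1] + C (c.rep 1) * linePoly G e ![ξ0, ξ1, 1]) ∨
          (C (c.rep 0) * linePoly F e ![ξ0, ξ1, 1] + C (c.rep 1) * linePoly G e ![ξ0, ξ1, 1]).degree < (d - 2 : ℕ) := by
        intro e he
        rw [he] at hv hw
        obtain ⟨α, β, rfl⟩ := Submodule.mem_span_pair.1 hv
        obtain ⟨γ, δ, rfl⟩ := Submodule.mem_span_pair.1 hw
        have hdet := pair_det hvw
        rw [← linePoly_lin]
        by_cases hα : α = 0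
        · right
          subst hα
          rw [zero_smul, zero_add] at hc
          exact contact_inf hd hh (by simpa using hdet) hc
        · left
          exact ⟨_, contact_fin hh hα hdet hc⟩
      rcases line_struct hxW' hW hv hw hvw with ⟨u, hu⟩ | hu
      · refine ⟨u, ?_, hu.symm⟩
        rw [hmem]
        rw [atU_FH, atU_FH]
        rcases main _ hu with ⟨z, hz⟩ | h
        · exact ⟨z, _, _, hc0, hz⟩
        · exfalso
          have hj := J_inf_contra hd (linePoly_natDegree hF _ _) (linePoly_natDegree hG _ _) hc0 h
          have := (hgood u).J_inf
          rw [atU_FH, atU_FH] at this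
          rcases this with h' | h'
          · exact h' hj.1
          · exact h' hj.2
      · exfalso
        rw [atU_FHs, atU_FHs] at hI
        rcases main _ hu with ⟨z, p, hz⟩ | h
        · have := dvd_flex_JJ hz hc0
          exact hI.J z this.1 this.2
        · have hj := J_inf_contra hd (linePoly_natDegree hF _ _) (linePoly_natDegree hG _ _) hc0 h
          rcases hI.J_inf with h' | h'
          · exact h' hj.1
          · exact h' hj.2
    · rintro ⟨u, hu, rfl⟩
      obtain ⟨z, l, μ, hl, hdvd⟩ := (hmem u).1 hu
      have he : ![1, u, 0] ∈ L u := Submodule.subset_span (by simp)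
      have hx' : ![ξ0, ξ1, 1] ∈ L u := Submodule.subset_span (by simp)
      have hli : LinearIndependent ℂ ![![1, u, 0], ![ξ0, ξ1, 1]] := linInd_e (by simp)
      have hne : ![l, μ] ≠ 0 := by
        intro h0
        have h1 := congrFun h0 0
        have h2 := congrFun h0 1
        simp at h1 h2
        simp [h1, h2] at hl
      refine ⟨?_, finrank_pair hli, Projectivization.mk ℂ ![l, μ] hne, ![1, u, 0] + z • ![ξ0, ξ1, 1], ![ξ0, ξ1, 1], ?_, hx', ?_, ?_⟩
      · rw [hxe]; exact (L u).smul_mem _ hx'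
      · exact (L u).add_mem he ((L u).smul_mem _ hx')
      · rw [LinearIndependent.pair_iff] at hli ⊢
        intro s t hst
        have := hli s (s * z + t) (by rw [← hst]; ext i; simp only [Pi.add_apply, Pi.smul_apply, smul_eq_mul]; ring)
        have h2 := this.2
        rw [this.1] at h2
        exact ⟨this.1, by simpa using h2⟩
      · obtain ⟨a, ha⟩ := Projectivization.exists_smul_eq_mk_rep ℂ ![l, μ] hne
        unfold ContactLE pencilMember
        rw [linePoly_lin, ← ha]
        have hcomp : ∀ H : MvPolynomial (Fin 3) ℂ, linePoly H (![1, u, 0] + z • ![ξ0, ξ1, 1]) ![ξ0, ξ1, 1] =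
            (atU u (FH H ξ0 ξ1)).comp (X + C z) := by
          intro H
          rw [atU_FH, linePoly_comp]
          unfold linePoly
          congr 2
          ext1 i
          simp only [Pi.add_apply, Pi.smul_apply, smul_eq_mul, C_add, C_mul]
          ring
        rw [hcomp, hcomp]
        obtain ⟨p, hp⟩ := hdvd
        have hp' := congrArg (fun q => q.comp (X + C z)) hp
        simp only [add_comp, mul_comp, C_comp, pow_comp, sub_comp, X_comp] at hp'
        refine ⟨C (a : ℂ) * p.comp (X + C z), ?_⟩
        have e0 : ((a • ![l, μ] : Fin 2 → ℂ) 0) = (a : ℂ) * l := by simp [Units.smul_def]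
        have e1 : ((a • ![l, μ] : Fin 2 → ℂ) 1) = (a : ℂ) * μ := by simp [Units.smul_def]
        rw [e0, e1, C_mul, C_mul]
        linear_combination C (a : ℂ) * hp'
  rw [hset]
  refine ⟨Finset.finite_toSet _, ?_⟩
  rw [Set.ncard_coe_finset, Finset.card_image_of_injective _ hLinj]
  obtain ⟨k, rfl⟩ := Nat.exists_eq_add_of_le hd
  have h2 : 2 * (3 + k) - 3 = 2 * k + 3 := by omega
  rw [h2] at hS
  have : ((S.card : ℤ)) + (3 + k) ^ 2 = (2 * k + 3) * (2 * (3 + k)) := by exact_mod_cast hS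
  push_cast
  linear_combination this


lemma exists_witness {d : ℕ} (hd : 3 ≤ d) {Q : MvPolynomial (IX d) ℂ} (hQ : Q ≠ 0) :
    ∃ (F G : MvPolynomial (Fin 3) ℂ) (x : Fin 3 → ℂ), F.IsHomogeneous d ∧ G.IsHomogeneous d ∧
      LinearIndependent ℂ ![F, G] ∧ MvPolynomial.eval (cvec d F G x) Q ≠ 0 := by
  classical
  let n1 : Fin 3 →₀ ℕ := Finsupp.single 0 d
  let n2 : Fin 3 →₀ ℕ := Finsupp.single 1 d
  have hn1 : n1 ∈ Idx d := by rw [mem_Idx]; simp [n1]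
  have hn2 : n2 ∈ Idx d := by rw [mem_Idx]; simp [n2]
  have hn : n1 ≠ n2 := by
    intro h
    have := congrArg (fun m => m 0) h
    simp [n1, n2] at this
    omega
  let m1 : {m // m ∈ Idx d} := ⟨n1, hn1⟩
  let m2 : {m // m ∈ Idx d} := ⟨n2, hn2⟩
  have hm : m1 ≠ m2 := fun h => hn (congrArg Subtype.val h)
  let M : MvPolynomial (IX d) ℂ := MvPolynomial.X (Sum.inl (Sum.inl m1)) * MvPolynomial.X (Sum.inl (Sum.inr m2)) -
    MvPolynomial.X (Sum.inl (Sum.inl m2)) * MvPolynomial.X (Sum.inl (Sum.inr m1))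
  have hM : M ≠ 0 := by
    intro h0
    have := congrArg (MvPolynomial.eval (Sum.elim (Sum.elim (fun m => if m = m1 then 1 else 0) (fun m => if m = m2 then 1 else 0))
      (fun _ => 0) : IX d → ℂ)) h0
    simp [M, hm, hm.symm] at this
  obtain ⟨a, ha⟩ : ∃ a, MvPolynomial.eval a (Q * M) ≠ 0 := by
    by_contra hcon
    push Not at hcon
    exact mul_ne_zero hQ hM (MvPolynomial.funext fun a => by rw [hcon a, map_zero])
  rw [map_mul] at ha
  let mk : ({m // m ∈ Idx d} → ℂ) → MvPolynomial (Fin 3) ℂ := fun c => ∑ m, MvPolynomial.monomial m.1 (c m)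
  have hmk : ∀ c (m : {m // m ∈ Idx d}), (mk c).coeff m.1 = c m := by
    intro c m
    simp only [mk, MvPolynomial.coeff_sum, MvPolynomial.coeff_monomial]
    rw [Finset.sum_eq_single m]
    · simp
    · intro b _ hb
      rw [if_neg]
      exact fun h => hb (Subtype.ext h)
    · simp
  have hhom : ∀ c, (mk c).IsHomogeneous d := by
    intro c
    apply MvPolynomial.IsHomogeneous.sum
    intro m _
    apply MvPolynomial.isHomogeneous_monomial
    have := mem_Idx.1 m.2
    rw [Finsupp.degree_eq_sum, Fin.sum_univ_three]
    exact this
  let F := mk fun m => a (Sum.inl (Sum.inl m))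
  let G := mk fun m => a (Sum.inl (Sum.inr m))
  have hcv : cvec d F G (fun i => a (Sum.inr i)) = a := by
    ext i
    rcases i with (m | m) | j
    · exact hmk _ m
    · exact hmk _ m
    · rfl
  refine ⟨F, G, fun i => a (Sum.inr i), hhom _, hhom _, ?_, ?_⟩
  · have hdet := right_ne_zero_of_mul ha
    simp only [M, map_sub, map_mul, MvPolynomial.eval_X] at hdet
    rw [LinearIndependent.pair_iff]
    intro s t hst
    have h1 := congrArg (MvPolynomial.coeff m1.1) hst
    have h2 := congrArg (MvPolynomial.coeff m2.1) hst
    simp only [MvPolynomial.coeff_add, MvPolynomial.coeff_smul, smul_eq_mul, F, G, hmk, MvPolynomial.coeff_zero] at h1 h2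
    constructor
    · apply (mul_eq_zero.1 (_ : s * _ = 0)).resolve_right hdet
      linear_combination a (Sum.inl (Sum.inr m2)) * h1 - a (Sum.inl (Sum.inr m1)) * h2
    · apply (mul_eq_zero.1 (_ : t * _ = 0)).resolve_right hdet
      linear_combination a (Sum.inl (Sum.inl m1)) * h2 - a (Sum.inl (Sum.inl m2)) * h1
  · rw [hcv]; exact left_ne_zero_of_mul ha

/-- For a general pencil of degree-`d` plane curves and a general point `[x] ∈ ℙ²`, the
number of lines through `[x]` that are flex tangent lines of some member of the pencil
is `3d(d−2)`. -/
theorem flex_lines_through_general_point_count (d : ℕ) (hd : 3 ≤ d) :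
    ∃ Q : MvPolynomial (((Fin 3 →₀ ℕ) ⊕ (Fin 3 →₀ ℕ)) ⊕ Fin 3) ℂ,
      (∃ (F G : MvPolynomial (Fin 3) ℂ) (x : Fin 3 → ℂ),
          F.IsHomogeneous d ∧ G.IsHomogeneous d ∧ LinearIndependent ℂ ![F, G] ∧ x ≠ 0 ∧
          MvPolynomial.eval (Sum.elim (coeffs2 F G) x) Q ≠ 0) ∧
      ∀ (F G : MvPolynomial (Fin 3) ℂ) (x : Fin 3 → ℂ),
        F.IsHomogeneous d → G.IsHomogeneous d → LinearIndependent ℂ ![F, G] → x ≠ 0 →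
        MvPolynomial.eval (Sum.elim (coeffs2 F G) x) Q ≠ 0 →
          (flexLinesThrough F G x).Finite ∧
            ((flexLinesThrough F G x).ncard : ℤ) = 3 * (d : ℤ) * ((d : ℤ) - 2) := by
  obtain ⟨Q, hQ, hgood⟩ := exists_Q_good hd
  let φ : IX d → ((Fin 3 →₀ ℕ) ⊕ (Fin 3 →₀ ℕ)) ⊕ Fin 3 := Sum.map (Sum.map Subtype.val Subtype.val) id
  have hev : ∀ F G x, MvPolynomial.eval (Sum.elim (coeffs2 F G) x) (MvPolynomial.rename φ Q) =
      MvPolynomial.eval (cvec d F G x) Q := by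
    intro F G x
    rw [MvPolynomial.eval_rename]
    congr 2
    ext i
    rcases i with (m | m) | j <;> rfl
  refine ⟨MvPolynomial.rename φ Q, ?_, ?_⟩
  · obtain ⟨F, G, x, hF, hG, hli, hne⟩ := exists_witness hd hQ
    refine ⟨F, G, x, hF, hG, hli, ?_, ?_⟩
    · rintro rfl
      exact (hgood F G 0 hF hG hne).1 rfl
    · rw [hev]; exact hne
  · intro F G x hF hG _ _ hne
    rw [hev] at hne
    obtain ⟨hx2, h⟩ := hgood F G x hF hG hne
    have hx : x = ![x 2 * (x 0 / x 2), x 2 * (x 1 / x 2), x 2] := by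
      ext i
      fin_cases i
      · simp; field_simp
      · simp; field_simp
      · simp
    obtain ⟨h1, h2⟩ := h _ _ hx
    exact flex_count hd hF hG hx2 hx h1 h2
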